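/- arXiv:1212.0467 — 3 statements merged into one kernel-verified Lean document; each statement's English description precedes it below -/
import Mathlib

section
/- Let M = U* Σ* (V*)ᵀ be a rank-k incoherent matrix with nonzero singular values σ*_1 ≥ ... ≥ σ*_k, and let 𝒜 : ℝ^{m×n} → ℝ^d satisfy 2k-RIP with RIP constant δ_{2k} < 1/(3200 k²). Run the Stage-AltMin algorithm on input 𝒜 and b = 𝒜(M) with T = Ω(log(‖M‖_F²/ε)) alternating steps per stage. Then for every stage i, the T-th step iterates Û^T_{1:i} ∈ ℝ^{m×i}, V̂^T_{1:i} ∈ ℝ^{n×i} satisfy ‖M − Û^T_{1:i}(V̂^T_{1:i})ᵀ‖_F² ≤ max(ε, 16k(σ*_{i+1})²); in particular the k-th stage iterates satisfy ‖M − Û^T_{1:k}(V̂^T_{1:k})ᵀ‖_F² ≤ ε. -/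
open Matrix MeasureTheory Finset

noncomputable section

namespace AltMin

/-- Euclidean norm of a finitely-indexed real vector. -/
def euclNorm {ι : Type*} [Fintype ι] (v : ι → ℝ) : ℝ :=
  Real.sqrt (∑ i, v i ^ 2)

/-- Frobenius norm of a real matrix. -/
def frobNorm {ι κ : Type*} [Fintype ι] [Fintype κ] (A : Matrix ι κ ℝ) : ℝ :=
  Real.sqrt (∑ i, ∑ j, A i j ^ 2)

/-- Spectral norm of a real matrix. -/
def specNorm {ι κ : Type*} [Fintype ι] [Fintype κ] (A : Matrix ι κ ℝ) : ℝ :=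
  sSup {r : ℝ | ∃ v : κ → ℝ, euclNorm v = 1 ∧ r = euclNorm (A.mulVec v)}

/-- Minimum singular value of a square real matrix. -/
def minSingVal {ι : Type*} [Fintype ι] (A : Matrix ι ι ℝ) : ℝ :=
  sInf {r : ℝ | ∃ v : ι → ℝ, euclNorm v = 1 ∧ r = euclNorm (A.mulVec v)}

/-- Orthogonal projection onto the column span of a (full column rank) matrix. -/
def colProj {m k : ℕ} (W : Matrix (Fin m) (Fin k) ℝ) : Matrix (Fin m) (Fin m) ℝ :=
  W * (Wᵀ * W)⁻¹ * Wᵀ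

/-- Principal-angle distance `dist(W₁, W₂) = ‖(W₁⊥)ᵀ W₂‖₂` between column spans,
expressed basis-independently via orthogonal projections. -/
def matDist {m k₁ k₂ : ℕ} (W₁ : Matrix (Fin m) (Fin k₁) ℝ)
    (W₂ : Matrix (Fin m) (Fin k₂) ℝ) : ℝ :=
  specNorm ((1 - colProj W₁) * colProj W₂)

/-- The linear measurement operator `𝒜(X)ᵢ = tr(Aᵢᵀ X)`. -/
def sense {m n d : ℕ} (A : Fin d → Matrix (Fin m) (Fin n) ℝ)
    (X : Matrix (Fin m) (Fin n) ℝ) : Fin d → ℝ :=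
  fun i => ((A i)ᵀ * X).trace

/-- The adjoint `𝒜ᵀ(y) = ∑ i, yᵢ Aᵢ` of the measurement operator. -/
def senseAdj {m n d : ℕ} (A : Fin d → Matrix (Fin m) (Fin n) ℝ) (y : Fin d → ℝ) :
    Matrix (Fin m) (Fin n) ℝ :=
  ∑ i, y i • A i

/-- `k`-restricted isometry property with constant `δ`. -/
def RIP {m n d : ℕ} (A : Fin d → Matrix (Fin m) (Fin n) ℝ) (k : ℕ) (δ : ℝ) : Prop :=
  ∀ X : Matrix (Fin m) (Fin n) ℝ, X.rank ≤ k →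
    (1 - δ) * frobNorm X ^ 2 ≤ euclNorm (sense A X) ^ 2 ∧
      euclNorm (sense A X) ^ 2 ≤ (1 + δ) * frobNorm X ^ 2

/-- `U` consists of top-`k` left singular vectors of `Y`:  `U` has orthonormal columns and
maximizes `‖U'ᵀ Y‖_F` over all matrices with orthonormal columns. -/
def IsTopKLeftSing {m n k : ℕ} (Y : Matrix (Fin m) (Fin n) ℝ)
    (U : Matrix (Fin m) (Fin k) ℝ) : Prop :=
  Uᵀ * U = 1 ∧ ∀ U' : Matrix (Fin m) (Fin k) ℝ, U'ᵀ * U' = 1 →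
    frobNorm (U'ᵀ * Y) ≤ frobNorm (Uᵀ * Y)

/-- `Z` is a best rank-`i` approximation of `Y` in Frobenius norm
(the top-`i` singular components of `Y`). -/
def IsBestRankApprox {m n : ℕ} (Y Z : Matrix (Fin m) (Fin n) ℝ) (i : ℕ) : Prop :=
  Z.rank ≤ i ∧ ∀ W : Matrix (Fin m) (Fin n) ℝ, W.rank ≤ i →
    frobNorm (Y - Z) ≤ frobNorm (Y - W)

/-- `P_Ω`: keep the entries in `Ω`, zero out the rest. -/
def projO {m n : ℕ} (Ω : Set (Fin m × Fin n)) (X : Matrix (Fin m) (Fin n) ℝ) :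
    Matrix (Fin m) (Fin n) ℝ :=
  fun i j => Set.indicator Ω (fun _ => X i j) (i, j)

/-- Clip to zero all entries of magnitude greater than `θ`. -/
def clip {m k : ℕ} (θ : ℝ) (W : Matrix (Fin m) (Fin k) ℝ) : Matrix (Fin m) (Fin k) ℝ :=
  fun i j => if θ < |W i j| then 0 else W i j

/-- Bernoulli measure with parameter `p` on `Bool`. -/
def bernoulliMeasure (p : ℝ) : Measure Bool :=
  ENNReal.ofReal p • Measure.dirac true + ENNReal.ofReal (1 - p) • Measure.dirac false

/-- Each entry of an `m × n` matrix is observed independently with probability `p`. -/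
def sampleMeasure (m n : ℕ) (p : ℝ) : Measure ((Fin m × Fin n) → Bool) :=
  Measure.pi fun _ => bernoulliMeasure p

instance optionMeasurableSpace {α : Type*} : MeasurableSpace (Option α) := ⊤

/-- Each entry is (independently) unobserved with probability `1 - p`, and observed and
assigned to one of `K` buckets uniformly otherwise. -/
def partMeasure (K : ℕ) (p : ℝ) : Measure (Option (Fin K)) :=
  ENNReal.ofReal (1 - p) • Measure.dirac none +
    ∑ t : Fin K, ENNReal.ofReal (p / K) • Measure.dirac (some t)

/-- Product sampling measure for the partitioned-observation model. -/
def partSampleMeasure (m n K : ℕ) (p : ℝ) : Measure ((Fin m × Fin n) → Option (Fin K)) :=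
  Measure.pi fun _ => partMeasure K p

/-- The `j`-th bucket of observed entries. -/
def partSet {m n K : ℕ} (ω : Fin m × Fin n → Option (Fin K)) (j : ℕ) :
    Set (Fin m × Fin n) :=
  {q | Option.map Fin.val (ω q) = some j}

end AltMin

namespace AltMin

section Frobenius

variable {ι κ τ : Type*} [Fintype ι] [Fintype κ] [Fintype τ]

/-- Frobenius inner product of real matrices. -/
def frobInner (X Y : Matrix ι κ ℝ) : ℝ := (Xᵀ * Y).trace

lemma frobInner_eq_sum (X Y : Matrix ι κ ℝ) :
    frobInner X Y = ∑ i, ∑ j, X i j * Y i j := by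
  simp only [frobInner, Matrix.trace, Matrix.diag, Matrix.mul_apply, Matrix.transpose_apply]
  exact Finset.sum_comm

lemma frobInner_comm (X Y : Matrix ι κ ℝ) : frobInner X Y = frobInner Y X := by
  simp only [frobInner_eq_sum, mul_comm]

lemma frobInner_add_left (X Y Z : Matrix ι κ ℝ) :
    frobInner (X + Y) Z = frobInner X Z + frobInner Y Z := by
  simp [frobInner, Matrix.add_mul]

lemma frobInner_sub_left (X Y Z : Matrix ι κ ℝ) :
    frobInner (X - Y) Z = frobInner X Z - frobInner Y Z := by
  simp [frobInner, Matrix.sub_mul]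

lemma frobInner_smul_left (a : ℝ) (X Z : Matrix ι κ ℝ) :
    frobInner (a • X) Z = a * frobInner X Z := by
  simp [frobInner]

lemma frobInner_add_right (X Y Z : Matrix ι κ ℝ) :
    frobInner Z (X + Y) = frobInner Z X + frobInner Z Y := by
  simp [frobInner, Matrix.mul_add]

lemma frobInner_sub_right (X Y Z : Matrix ι κ ℝ) :
    frobInner Z (X - Y) = frobInner Z X - frobInner Z Y := by
  simp [frobInner, Matrix.mul_sub]

lemma frobInner_smul_right (a : ℝ) (X Z : Matrix ι κ ℝ) :
    frobInner Z (a • X) = a * frobInner Z X := by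
  simp [frobInner]

lemma frobInner_mul_left (P : Matrix τ ι ℝ) (X : Matrix ι κ ℝ) (Y : Matrix τ κ ℝ) :
    frobInner (P * X) Y = frobInner X (Pᵀ * Y) := by
  simp [frobInner, Matrix.transpose_mul, Matrix.mul_assoc]

lemma frobNorm_nonneg (X : Matrix ι κ ℝ) : 0 ≤ frobNorm X := Real.sqrt_nonneg _

lemma frobNorm_sq (X : Matrix ι κ ℝ) : frobNorm X ^ 2 = frobInner X X := by
  rw [frobNorm, Real.sq_sqrt (by positivity), frobInner_eq_sum]
  simp only [sq]

lemma frobNorm_transpose (X : Matrix ι κ ℝ) : frobNorm Xᵀ = frobNorm X := by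
  simp only [frobNorm, Matrix.transpose_apply]
  rw [Finset.sum_comm]

lemma frobInner_mul_right (Q : Matrix κ τ ℝ) (X : Matrix ι κ ℝ) (Y : Matrix ι τ ℝ) :
    frobInner (X * Q) Y = frobInner X (Y * Qᵀ) := by
  simp only [frobInner, Matrix.transpose_mul, Matrix.mul_assoc]
  rw [Matrix.trace_mul_comm, Matrix.mul_assoc]

open scoped Matrix.Norms.Frobenius in
lemma frobNorm_eq_norm (X : Matrix ι κ ℝ) : frobNorm X = ‖X‖ := by
  rw [Matrix.frobenius_norm_def, frobNorm, Real.sqrt_eq_rpow]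
  simp

open scoped Matrix.Norms.Frobenius in
lemma frobNorm_add_le (X Y : Matrix ι κ ℝ) : frobNorm (X + Y) ≤ frobNorm X + frobNorm Y := by
  simp only [frobNorm_eq_norm]
  exact norm_add_le X Y

open scoped Matrix.Norms.Frobenius in
lemma frobNorm_sub_le (X Y : Matrix ι κ ℝ) : frobNorm (X - Y) ≤ frobNorm X + frobNorm Y := by
  simp only [frobNorm_eq_norm]
  exact norm_sub_le X Y

lemma frobNorm_neg (X : Matrix ι κ ℝ) : frobNorm (-X) = frobNorm X := by
  simp [frobNorm]

lemma frobNorm_zero : frobNorm (0 : Matrix ι κ ℝ) = 0 := by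
  simp [frobNorm]

open scoped Matrix.Norms.Frobenius in
lemma frobNorm_smul (a : ℝ) (X : Matrix ι κ ℝ) : frobNorm (a • X) = |a| * frobNorm X := by
  simp only [frobNorm_eq_norm, norm_smul, Real.norm_eq_abs]

lemma frobNorm_mul_le (X : Matrix ι κ ℝ) (Y : Matrix κ τ ℝ) :
    frobNorm (X * Y) ≤ frobNorm X * frobNorm Y := by
  simp only [frobNorm_eq_norm]
  exact Matrix.frobenius_norm_mul X Y

lemma abs_frobInner_le (X Y : Matrix ι κ ℝ) :
    |frobInner X Y| ≤ frobNorm X * frobNorm Y := by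
  have h := Finset.sum_mul_sq_le_sq_mul_sq Finset.univ
    (fun p : ι × κ => X p.1 p.2) (fun p : ι × κ => Y p.1 p.2)
  simp only [Fintype.sum_prod_type] at h
  rw [← frobInner_eq_sum] at h
  refine abs_le_of_sq_le_sq ?_ (mul_nonneg (frobNorm_nonneg _) (frobNorm_nonneg _))
  rw [mul_pow, frobNorm, frobNorm, Real.sq_sqrt (by positivity), Real.sq_sqrt (by positivity)]
  exact h

open scoped Matrix.Norms.Frobenius in
lemma eq_zero_of_frobNorm_eq_zero {X : Matrix ι κ ℝ} (h : frobNorm X = 0) : X = 0 := by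
  rw [frobNorm_eq_norm] at h
  exact norm_eq_zero.mp h

end Frobenius

section Rank

variable {m n : ℕ}

lemma rank_add_le (X Y : Matrix (Fin m) (Fin n) ℝ) : (X + Y).rank ≤ X.rank + Y.rank := by
  have hle : (X + Y).mulVecLin.range ≤ X.mulVecLin.range ⊔ Y.mulVecLin.range := by
    rw [Matrix.mulVecLin_add]
    rintro _ ⟨v, rfl⟩
    exact Submodule.add_mem_sup ⟨v, rfl⟩ ⟨v, rfl⟩
  exact (Submodule.finrank_mono hle).trans (Submodule.finrank_add_le_finrank_add_finrank _ _)

lemma rank_smul_le (a : ℝ) (X : Matrix (Fin m) (Fin n) ℝ) : (a • X).rank ≤ X.rank := by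
  have h : a • X = (a • (1 : Matrix (Fin m) (Fin m) ℝ)) * X := by simp
  rw [h]
  exact Matrix.rank_mul_le_right _ _

lemma rank_neg_le (X : Matrix (Fin m) (Fin n) ℝ) : (-X).rank ≤ X.rank := by
  simpa using rank_smul_le (-1) X

lemma rank_sub_le (X Y : Matrix (Fin m) (Fin n) ℝ) : (X - Y).rank ≤ X.rank + Y.rank := by
  rw [sub_eq_add_neg]
  exact (rank_add_le _ _).trans (Nat.add_le_add_left (rank_neg_le Y) _)

end Rank

section Projection

/-- Matrices of orthogonal projections. -/
def IsOrthProj {ι : Type*} [Fintype ι] (P : Matrix ι ι ℝ) : Prop := Pᵀ = P ∧ P * P = P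

variable {ι κ : Type*} [Fintype ι] [Fintype κ]

lemma IsOrthProj.compl [DecidableEq ι] {P : Matrix ι ι ℝ} (hP : IsOrthProj P) : IsOrthProj (1 - P) := by
  refine ⟨by simp [hP.1], ?_⟩
  simp [Matrix.mul_sub, Matrix.sub_mul, hP.2]

lemma IsOrthProj.frobInner_mul {P : Matrix ι ι ℝ} (hP : IsOrthProj P) (X : Matrix ι κ ℝ) :
    frobInner X (P * X) = frobNorm (P * X) ^ 2 := by
  rw [frobNorm_sq, frobInner_mul_left, hP.1, ← Matrix.mul_assoc, hP.2]

lemma IsOrthProj.frobInner_mul' {Q : Matrix κ κ ℝ} (hQ : IsOrthProj Q) (X : Matrix ι κ ℝ) :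
    frobInner X (X * Q) = frobNorm (X * Q) ^ 2 := by
  rw [frobNorm_sq, frobInner_mul_right, hQ.1, Matrix.mul_assoc, hQ.2]

lemma IsOrthProj.pythagoras [DecidableEq ι] {P : Matrix ι ι ℝ} (hP : IsOrthProj P) (X : Matrix ι κ ℝ) :
    frobNorm X ^ 2 = frobNorm (P * X) ^ 2 + frobNorm ((1 - P) * X) ^ 2 := by
  rw [← hP.frobInner_mul, ← hP.compl.frobInner_mul, ← frobInner_add_right, frobNorm_sq]
  simp [Matrix.sub_mul]

lemma IsOrthProj.frobNorm_mul_le [DecidableEq ι] {P : Matrix ι ι ℝ} (hP : IsOrthProj P) (X : Matrix ι κ ℝ) :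
    frobNorm (P * X) ≤ frobNorm X := by
  refine le_of_sq_le_sq ?_ (frobNorm_nonneg _)
  rw [hP.pythagoras X]
  linarith [sq_nonneg (frobNorm ((1 - P) * X))]

lemma IsOrthProj.frobNorm_mul_le' [DecidableEq κ] {Q : Matrix κ κ ℝ} (hQ : IsOrthProj Q) (X : Matrix ι κ ℝ) :
    frobNorm (X * Q) ≤ frobNorm X := by
  rw [← frobNorm_transpose, Matrix.transpose_mul, hQ.1, ← frobNorm_transpose X]
  exact hQ.frobNorm_mul_le _

lemma exists_isOrthProj [DecidableEq ι] [DecidableEq κ] (U : Matrix ι κ ℝ) :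
    ∃ (P : Matrix ι ι ℝ) (G : Matrix κ ι ℝ), IsOrthProj P ∧ P * U = U ∧ P = U * G := by
  set S : Submodule ℝ (EuclideanSpace ℝ ι) := LinearMap.range (Matrix.toEuclideanLin U) with hS
  set e := Matrix.toEuclideanCLM (𝕜 := ℝ) (n := ι)
  set P : Matrix ι ι ℝ := e.symm S.starProjection with hPdef
  have heP : e P = S.starProjection := by simp [hPdef]
  have hstar : IsStarProjection S.starProjection := isStarProjection_starProjection
  have happ : ∀ x : ι → ℝ, S.starProjection (WithLp.toLp 2 x) = WithLp.toLp 2 (P *ᵥ x) := by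
    intro x
    rw [← heP]
    exact Matrix.toEuclideanCLM_toLp P x
  have hG : ∀ l : ι, ∃ g : κ → ℝ, U *ᵥ g = P *ᵥ Pi.single l 1 := by
    intro l
    have hmem : S.starProjection (WithLp.toLp 2 (Pi.single l 1)) ∈ S :=
      Submodule.starProjection_apply_mem _ _
    rw [happ] at hmem
    obtain ⟨g, hg⟩ := hmem
    refine ⟨WithLp.ofLp g, ?_⟩
    have := congrArg WithLp.ofLp hg
    simpa using this
  choose g hg using hG
  refine ⟨P, Matrix.of fun a l => g l a, ⟨?_, ?_⟩, ?_, ?_⟩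
  · have h : star P = P := by
      apply EquivLike.injective e
      rw [map_star, heP]
      exact hstar.isSelfAdjoint
    rwa [Matrix.star_eq_conjTranspose, Matrix.conjTranspose_eq_transpose_of_trivial] at h
  · apply EquivLike.injective e
    rw [map_mul, heP]
    exact hstar.isIdempotentElem
  · have hcol : ∀ a : κ, P *ᵥ (fun i => U i a) = fun i => U i a := by
      intro a
      have hmem : (WithLp.toLp 2 (fun i => U i a) : EuclideanSpace ℝ ι) ∈ S := by
        refine ⟨WithLp.toLp 2 (Pi.single a 1), ?_⟩
        ext i
        simp [Matrix.toEuclideanLin]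
      have := (Submodule.starProjection_eq_self_iff (K := S)).mpr hmem
      rw [happ] at this
      exact congrArg WithLp.ofLp this
    ext i a
    exact congrFun (hcol a) i
  · ext i l
    have := congrFun (hg l) i
    simp only [Matrix.mulVec_single_one] at this
    exact this.symm

end Projection

section Measurement

variable {m n d k : ℕ} {A : Fin d → Matrix (Fin m) (Fin n) ℝ} {δ : ℝ}

lemma euclNorm_sq {ι : Type*} [Fintype ι] (v : ι → ℝ) : euclNorm v ^ 2 = v ⬝ᵥ v := by
  rw [euclNorm, Real.sq_sqrt (by positivity)]
  simp only [dotProduct, sq]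

lemma sense_add (A : Fin d → Matrix (Fin m) (Fin n) ℝ) (X Y : Matrix (Fin m) (Fin n) ℝ) :
    sense A (X + Y) = sense A X + sense A Y := by
  ext i
  simp [sense, Matrix.mul_add]

lemma sense_sub (A : Fin d → Matrix (Fin m) (Fin n) ℝ) (X Y : Matrix (Fin m) (Fin n) ℝ) :
    sense A (X - Y) = sense A X - sense A Y := by
  ext i
  simp [sense, Matrix.mul_sub]

lemma sense_smul (A : Fin d → Matrix (Fin m) (Fin n) ℝ) (a : ℝ)
    (X : Matrix (Fin m) (Fin n) ℝ) : sense A (a • X) = a • sense A X := by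
  ext i
  simp [sense]

lemma sense_zero (A : Fin d → Matrix (Fin m) (Fin n) ℝ) : sense A 0 = 0 := by
  ext i
  simp [sense]

/-- The bilinear form `⟨𝒜(X), 𝒜(Y)⟩`. -/
def senseInner (A : Fin d → Matrix (Fin m) (Fin n) ℝ) (X Y : Matrix (Fin m) (Fin n) ℝ) : ℝ :=
  sense A X ⬝ᵥ sense A Y

/-- The squared residual `‖𝒜(X)‖₂²`. -/
def energy (A : Fin d → Matrix (Fin m) (Fin n) ℝ) (X : Matrix (Fin m) (Fin n) ℝ) : ℝ :=
  euclNorm (sense A X) ^ 2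

lemma senseInner_comm (X Y : Matrix (Fin m) (Fin n) ℝ) :
    senseInner A X Y = senseInner A Y X := dotProduct_comm _ _

lemma senseInner_add_right (X Y Z : Matrix (Fin m) (Fin n) ℝ) :
    senseInner A X (Y + Z) = senseInner A X Y + senseInner A X Z := by
  simp [senseInner, sense_add]

lemma senseInner_sub_right (X Y Z : Matrix (Fin m) (Fin n) ℝ) :
    senseInner A X (Y - Z) = senseInner A X Y - senseInner A X Z := by
  simp [senseInner, sense_sub]

lemma senseInner_add_left (X Y Z : Matrix (Fin m) (Fin n) ℝ) :
    senseInner A (X + Y) Z = senseInner A X Z + senseInner A Y Z := by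
  simp [senseInner, sense_add]

lemma senseInner_sub_left (X Y Z : Matrix (Fin m) (Fin n) ℝ) :
    senseInner A (X - Y) Z = senseInner A X Z - senseInner A Y Z := by
  simp [senseInner, sense_sub]

lemma senseInner_smul_left (a : ℝ) (X Y : Matrix (Fin m) (Fin n) ℝ) :
    senseInner A (a • X) Y = a * senseInner A X Y := by
  simp [senseInner, sense_smul]

lemma senseInner_smul_right (a : ℝ) (X Y : Matrix (Fin m) (Fin n) ℝ) :
    senseInner A X (a • Y) = a * senseInner A X Y := by
  simp [senseInner, sense_smul]

lemma energy_eq (X : Matrix (Fin m) (Fin n) ℝ) : energy A X = senseInner A X X :=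
  euclNorm_sq _

lemma energy_neg (X : Matrix (Fin m) (Fin n) ℝ) : energy A (-X) = energy A X := by
  rw [energy_eq, energy_eq, ← neg_one_smul ℝ X, senseInner_smul_left, senseInner_smul_right]
  ring

lemma frobInner_senseAdj (E G : Matrix (Fin m) (Fin n) ℝ) :
    frobInner G (senseAdj A (sense A E)) = senseInner A E G := by
  rw [frobInner_comm]
  simp only [senseAdj, frobInner, senseInner, dotProduct, sense, Matrix.transpose_sum,
    Matrix.sum_mul, Matrix.trace_sum, Matrix.transpose_smul, Matrix.smul_mul,
    Matrix.trace_smul, smul_eq_mul]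

lemma energy_le_energy {X Y M : Matrix (Fin m) (Fin n) ℝ}
    (h : euclNorm (sense A X - sense A M) ≤ euclNorm (sense A Y - sense A M)) :
    energy A (X - M) ≤ energy A (Y - M) := by
  rw [energy, energy, sense_sub, sense_sub]
  exact pow_le_pow_left₀ (Real.sqrt_nonneg _) h 2

lemma RIP.energy_le (h : RIP A k δ) {X : Matrix (Fin m) (Fin n) ℝ} (hX : X.rank ≤ k) :
    energy A X ≤ (1 + δ) * frobNorm X ^ 2 := (h X hX).2

lemma RIP.le_energy (h : RIP A k δ) {X : Matrix (Fin m) (Fin n) ℝ} (hX : X.rank ≤ k) :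
    (1 - δ) * frobNorm X ^ 2 ≤ energy A X := (h X hX).1

lemma RIP.abs_senseInner_sub_le (h : RIP A k δ) {E G : Matrix (Fin m) (Fin n) ℝ}
    (hr : ∀ a b : ℝ, (a • E + b • G).rank ≤ k) :
    |senseInner A E G - frobInner E G| ≤ δ * frobNorm E * frobNorm G := by
  rcases (frobNorm_nonneg E).eq_or_lt with hE | hE
  · rw [eq_zero_of_frobNorm_eq_zero hE.symm]
    simp [senseInner, frobInner, frobNorm_zero, sense_zero]
  rcases (frobNorm_nonneg G).eq_or_lt with hG | hG
  · rw [eq_zero_of_frobNorm_eq_zero hG.symm]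
    simp [senseInner, frobInner, frobNorm_zero, sense_zero]
  set x := frobNorm E with hx
  set y := frobNorm G with hy
  have h1 := h.energy_le (hr y x)
  have h2 := h.le_energy (hr y x)
  have h3 := h.energy_le (hr y (-x))
  have h4 := h.le_energy (hr y (-x))
  simp only [energy_eq, frobNorm_sq, senseInner_add_left, senseInner_add_right,
    senseInner_smul_left, senseInner_smul_right, frobInner_add_left, frobInner_add_right,
    frobInner_smul_left, frobInner_smul_right] at h1 h2 h3 h4
  rw [← frobNorm_sq E, ← frobNorm_sq G, ← hx, ← hy, senseInner_comm G E,
    frobInner_comm G E] at h1 h2 h3 h4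
  have hxy : 0 < x * y := mul_pos hE hG
  rw [abs_le]
  constructor
  · refine le_of_mul_le_mul_left ?_ hxy
    nlinarith
  · refine le_of_mul_le_mul_left ?_ hxy
    nlinarith

/-- First-order optimality of `E` along `H` makes the projection `H` of `E` small. -/
lemma RIP.frobNorm_le_of_stationary (h : RIP A k δ) {E H : Matrix (Fin m) (Fin n) ℝ}
    (hr : ∀ a b : ℝ, (a • E + b • H).rank ≤ k)
    (hH : frobInner E H = frobNorm H ^ 2)
    (hmin : ∀ t : ℝ, energy A E ≤ energy A (E + t • H)) :
    frobNorm H ≤ δ * frobNorm E := by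
  have hzero : senseInner A E H = 0 := by
    have hq : ∀ t : ℝ, 0 ≤ energy A H * (t * t) + (2 * senseInner A E H) * t + 0 := by
      intro t
      have := hmin t
      simp only [energy_eq, senseInner_add_left, senseInner_add_right,
        senseInner_smul_left, senseInner_smul_right, senseInner_comm H E] at this ⊢
      linarith
    have := discrim_le_zero hq
    rw [discrim] at this
    nlinarith
  have hab := h.abs_senseInner_sub_le hr
  rw [hzero, hH, zero_sub, abs_neg, abs_of_nonneg (sq_nonneg _)] at hab
  rcases (frobNorm_nonneg H).eq_or_lt with h0 | h0
  · have := hr 1 0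
    rw [one_smul, zero_smul, add_zero] at this
    have h1 := (h.le_energy this).trans (h.energy_le this)
    rw [← h0]
    rcases (frobNorm_nonneg E).eq_or_lt with h2 | h2
    · rw [← h2]; simp
    · have : 0 ≤ δ * frobNorm E * frobNorm E := by nlinarith
      nlinarith
  · nlinarith

end Measurement

section SingularValueProjection

variable {m n d j k : ℕ} {A : Fin d → Matrix (Fin m) (Fin n) ℝ} {δ : ℝ}
  {M X Z W : Matrix (Fin m) (Fin n) ℝ}

lemma rank_smul_add_smul_le (E G : Matrix (Fin m) (Fin n) ℝ) (a b : ℝ) :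
    (a • E + b • G).rank ≤ E.rank + G.rank :=
  (rank_add_le _ _).trans (add_le_add (rank_smul_le a E) (rank_smul_le b G))

/-- A difference of two matrices of rank at most `k` splits orthogonally into two such pieces. -/
lemma exists_isOrthProj_rank_le (hX : X.rank ≤ k) (hW : W.rank ≤ k) :
    ∃ P : Matrix (Fin m) (Fin m) ℝ, IsOrthProj P ∧
      (P * (X - W)).rank ≤ k ∧ ((1 - P) * (X - W)).rank ≤ k := by
  obtain ⟨P, G, hP, hPX, hPG⟩ := exists_isOrthProj X
  refine ⟨P, hP, ?_, ?_⟩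
  · rw [hPG, Matrix.mul_assoc]
    exact (Matrix.rank_mul_le_left _ _).trans hX
  · have : (1 - P) * (X - W) = -((1 - P) * W) := by
      rw [Matrix.mul_sub, Matrix.sub_mul, hPX]
      simp
    rw [this]
    exact (rank_neg_le _).trans ((Matrix.rank_mul_le_right _ _).trans hW)

lemma RIP.abs_senseInner_sub_le_four (h : RIP A (2 * k) δ) (hδ : 0 ≤ δ)
    {X₁ X₂ Y₁ Y₂ : Matrix (Fin m) (Fin n) ℝ} (hX₁ : X₁.rank ≤ k) (hX₂ : X₂.rank ≤ k)
    (hY₁ : Y₁.rank ≤ k) (hY₂ : Y₂.rank ≤ k) :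
    |senseInner A (X₁ - X₂) (Y₁ - Y₂) - frobInner (X₁ - X₂) (Y₁ - Y₂)| ≤
      4 * δ * frobNorm (X₁ - X₂) * frobNorm (Y₁ - Y₂) := by
  obtain ⟨P, hP, hP1, hP2⟩ := exists_isOrthProj_rank_le hX₁ hX₂
  obtain ⟨R, hR, hR1, hR2⟩ := exists_isOrthProj_rank_le hY₁ hY₂
  generalize X₁ - X₂ = E at *
  generalize Y₁ - Y₂ = G at *
  have key : ∀ E' G' : Matrix (Fin m) (Fin n) ℝ, E'.rank ≤ k → G'.rank ≤ k →
      frobNorm E' ≤ frobNorm E → frobNorm G' ≤ frobNorm G →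
      |senseInner A E' G' - frobInner E' G'| ≤ δ * frobNorm E * frobNorm G := by
    intro E' G' h1 h2 h3 h4
    refine (h.abs_senseInner_sub_le fun a b =>
      (rank_smul_add_smul_le E' G' a b).trans (by omega)).trans ?_
    have := frobNorm_nonneg E'
    have := frobNorm_nonneg G'
    have := frobNorm_nonneg E
    gcongr
  have k1 := key _ _ hP1 hR1 (hP.frobNorm_mul_le E) (hR.frobNorm_mul_le G)
  have k2 := key _ _ hP1 hR2 (hP.frobNorm_mul_le E) (hR.compl.frobNorm_mul_le G)
  have k3 := key _ _ hP2 hR1 (hP.compl.frobNorm_mul_le E) (hR.frobNorm_mul_le G)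
  have k4 := key _ _ hP2 hR2 (hP.compl.frobNorm_mul_le E) (hR.compl.frobNorm_mul_le G)
  have hE : E = P * E + (1 - P) * E := by simp [Matrix.sub_mul]
  have hG : G = R * G + (1 - R) * G := by simp [Matrix.sub_mul]
  have hs : senseInner A E G = senseInner A (P * E) (R * G) + senseInner A (P * E) ((1 - R) * G) +
      (senseInner A ((1 - P) * E) (R * G) + senseInner A ((1 - P) * E) ((1 - R) * G)) := by
    rw [← senseInner_add_right, ← senseInner_add_right, ← senseInner_add_left, ← hE, ← hG]
  have hf : frobInner E G = frobInner (P * E) (R * G) + frobInner (P * E) ((1 - R) * G) +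
      (frobInner ((1 - P) * E) (R * G) + frobInner ((1 - P) * E) ((1 - R) * G)) := by
    rw [← frobInner_add_right, ← frobInner_add_right, ← frobInner_add_left, ← hE, ← hG]
  rw [hs, hf]
  rw [abs_le] at *
  constructor <;> linarith [k1.1, k1.2, k2.1, k2.2, k3.1, k3.2, k4.1, k4.2]

/-- Variational inequality satisfied by one SVP step `Z` from `X`. -/
lemma IsBestRankApprox.svp_le
    (hZ : IsBestRankApprox (X - (3 / 4 : ℝ) • senseAdj A (sense A X - sense A M)) Z j)
    (hW : W.rank ≤ j) :
    frobNorm (Z - X) ^ 2 + 3 / 2 * senseInner A (X - M) (Z - X) ≤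
      frobNorm (W - X) ^ 2 + 3 / 2 * senseInner A (X - M) (W - X) := by
  have h := pow_le_pow_left₀ (frobNorm_nonneg _) (hZ.2 W hW) 2
  rw [← sense_sub] at h
  set N := senseAdj A (sense A (X - M)) with hN
  have hexp : ∀ V : Matrix (Fin m) (Fin n) ℝ, frobNorm (X - (3 / 4 : ℝ) • N - V) ^ 2 =
      frobNorm (V - X) ^ 2 + 3 / 2 * senseInner A (X - M) (V - X) +
        9 / 16 * frobNorm N ^ 2 := by
    intro V
    rw [← frobInner_senseAdj, ← hN]
    simp only [frobNorm_sq, frobInner_sub_left, frobInner_sub_right, frobInner_smul_left,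
      frobInner_smul_right, frobInner_comm N, frobInner_comm X V]
    ring
  rw [hexp, hexp] at h
  linarith

lemma IsBestRankApprox.svp_energy_le (h : RIP A (2 * k) δ) (hδ : δ ≤ 1 / 3)
    (hZ : IsBestRankApprox (X - (3 / 4 : ℝ) • senseAdj A (sense A X - sense A M)) Z j)
    (hW : W.rank ≤ j) (hX : X.rank ≤ k) (hj : j ≤ k) :
    energy A (Z - M) ≤ energy A (W - M) + (1 / 3 + δ) * frobNorm (W - X) ^ 2 := by
  have h1 := hZ.svp_le hW
  have h2 := h.energy_le (X := Z - X) ((rank_sub_le _ _).trans (by have := hZ.1; omega))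
  have h3 := h.le_energy (X := W - X) ((rank_sub_le _ _).trans (by omega))
  have h4 := sq_nonneg (frobNorm (Z - X))
  have hexp : ∀ V : Matrix (Fin m) (Fin n) ℝ, energy A (V - M) =
      energy A (X - M) + 2 * senseInner A (X - M) (V - X) + energy A (V - X) := by
    intro V
    simp only [energy_eq, senseInner_sub_left, senseInner_sub_right, senseInner_comm V,
      senseInner_comm M X]
    ring
  rw [hexp Z, hexp W]
  nlinarith

/-- One SVP step from a matrix `X` whose row space (captured by `Q`) is nearly stationary finds
a column space capturing `M` up to the tail `R` and a multiple of the previous error. -/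
lemma IsBestRankApprox.svp_frobNorm_le (h : RIP A (2 * k) δ) (hδ : 0 ≤ δ)
    (hZ : IsBestRankApprox (X - (3 / 4 : ℝ) • senseAdj A (sense A X - sense A M)) Z j)
    (hX : X.rank ≤ k) (hM : M.rank ≤ k) (hj : j ≤ k)
    {Mj R : Matrix (Fin m) (Fin n) ℝ} (hMj : M = Mj + R) (hMjr : Mj.rank ≤ j)
    {Q : Matrix (Fin n) (Fin n) ℝ} (hQ : IsOrthProj Q) (hXQ : X * Q = X)
    (hEQ : frobNorm ((X - M) * Q) ≤ δ * frobNorm (X - M))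
    {P : Matrix (Fin m) (Fin m) ℝ} (hP : IsOrthProj P) (hPZ : P * Z = Z) :
    frobNorm ((1 - P) * M) ≤ 5 / 3 * (frobNorm R + 8 * δ * frobNorm (X - M)) := by
  set D : Matrix (Fin n) (Fin n) ℝ := (3 / 4 : ℝ) • 1 + (1 / 4 : ℝ) • Q with hD
  set E := X - M with hE
  set W := Mj * D with hW
  have hWr : W.rank ≤ j := (Matrix.rank_mul_le_left _ _).trans hMjr
  have h1 := hZ.svp_le hWr
  rw [← hE] at h1
  have h2 := h.abs_senseInner_sub_le_four hδ hX hM (hZ.1.trans hj) (hWr.trans hj)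
  rw [← hE] at h2
  have h3 := abs_frobInner_le (E * Q) (Z - W)
  have h4 : frobNorm (Z - W) ≤ frobNorm (Z - M * D) + frobNorm (W - M * D) := by
    have : Z - W = (Z - M * D) - (W - M * D) := by abel
    rw [this]
    exact frobNorm_sub_le _ _
  have hBX : M * D - X = -(3 / 4 : ℝ) • E - (1 / 4 : ℝ) • (E * Q) := by
    simp only [hD, hE, Matrix.mul_add, Matrix.mul_smul, Matrix.mul_one, Matrix.sub_mul, hXQ]
    module
  have hpolar : frobNorm (Z - X) ^ 2 - frobNorm (W - X) ^ 2 =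
      frobNorm (Z - M * D) ^ 2 - frobNorm (W - M * D) ^ 2 +
        2 * frobInner (M * D - X) (Z - W) := by
    simp only [frobNorm_sq, frobInner_sub_left, frobInner_sub_right, frobInner_comm Z,
      frobInner_comm W]
    ring
  rw [hBX, frobInner_sub_left, frobInner_smul_left, frobInner_smul_left] at hpolar
  have hsub : senseInner A E (Z - W) = senseInner A E (Z - X) - senseInner A E (W - X) := by
    rw [← senseInner_sub_right]
    congr 1
    abel
  have hE0 := frobNorm_nonneg E
  have hG0 := frobNorm_nonneg (Z - W)
  have hq0 := frobNorm_nonneg (Z - M * D)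
  have hp0 := frobNorm_nonneg (W - M * D)
  have hν : 0 ≤ δ * frobNorm E := mul_nonneg hδ hE0
  have h3' : |frobInner (E * Q) (Z - W)| ≤ δ * frobNorm E * frobNorm (Z - W) :=
    h3.trans (mul_le_mul_of_nonneg_right hEQ hG0)
  rw [abs_le] at h2 h3'
  have hmain : frobNorm (Z - M * D) ^ 2 ≤ frobNorm (W - M * D) ^ 2 +
      8 * (δ * frobNorm E) * (frobNorm (Z - M * D) + frobNorm (W - M * D)) := by
    have h5 : frobNorm (Z - M * D) ^ 2 ≤ frobNorm (W - M * D) ^ 2 +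
        8 * (δ * frobNorm E) * frobNorm (Z - W) := by
      have : 0 ≤ δ * frobNorm E * frobNorm (Z - W) := mul_nonneg hν hG0
      nlinarith [h2.1, h2.2, h3'.1, h3'.2]
    have h6 : 8 * (δ * frobNorm E) * frobNorm (Z - W) ≤
        8 * (δ * frobNorm E) * (frobNorm (Z - M * D) + frobNorm (W - M * D)) := by
      gcongr
    linarith
  have hq : frobNorm (Z - M * D) ≤ frobNorm (W - M * D) + 8 * (δ * frobNorm E) := by
    by_contra hcon
    push Not at hcon
    nlinarith
  have hp : frobNorm (W - M * D) ≤ frobNorm R := by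
    have h7 : W - M * D = -((3 / 4 : ℝ) • R + (1 / 4 : ℝ) • (R * Q)) := by
      rw [hW, hMj, hD]
      simp only [Matrix.mul_add, Matrix.mul_smul, Matrix.mul_one, Matrix.add_mul]
      module
    rw [h7, frobNorm_neg]
    refine (frobNorm_add_le _ _).trans ?_
    rw [frobNorm_smul, frobNorm_smul, abs_of_pos (by norm_num), abs_of_pos (by norm_num)]
    linarith [hQ.frobNorm_mul_le' R]
  have hinv : (1 - P) * M = (4 / 3 : ℝ) • (((1 - P) * (M * D - Z))) -
      (1 / 3 : ℝ) • (((1 - P) * (M * D - Z)) * Q) := by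
    have h8 : (1 - P) * (M * D - Z) = (1 - P) * M * D := by
      rw [Matrix.mul_sub, Matrix.sub_mul 1 P Z, hPZ]
      simp [Matrix.mul_assoc]
    rw [h8, hD]
    generalize (1 - P) * M = B
    simp only [Matrix.mul_add, Matrix.mul_smul, Matrix.mul_one, Matrix.add_mul, Matrix.smul_mul,
      Matrix.mul_assoc, hQ.2]
    module
  rw [hinv]
  refine (frobNorm_sub_le _ _).trans ?_
  rw [frobNorm_smul, frobNorm_smul, abs_of_pos (by norm_num), abs_of_pos (by norm_num)]
  have h9 := hQ.frobNorm_mul_le' ((1 - P) * (M * D - Z))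
  have h10 := hP.compl.frobNorm_mul_le (M * D - Z)
  have h11 : frobNorm (M * D - Z) = frobNorm (Z - M * D) := by
    rw [← frobNorm_neg, neg_sub]
  linarith

end SingularValueProjection

section Truncation

variable {m n k : ℕ}

lemma frobNorm_orthonormal_mul {ι κ τ : Type*} [Fintype ι] [Fintype κ] [Fintype τ]
    [DecidableEq κ] {U : Matrix ι κ ℝ} (hU : Uᵀ * U = 1) (X : Matrix κ τ ℝ) :
    frobNorm (U * X) = frobNorm X := by
  refine (pow_left_inj₀ (frobNorm_nonneg _) (frobNorm_nonneg _) two_ne_zero).mp ?_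
  rw [frobNorm_sq, frobInner_mul_left, ← Matrix.mul_assoc, hU, Matrix.one_mul, frobNorm_sq]

lemma frobNorm_transpose_orthonormal_mul_le {ι κ τ : Type*} [Fintype ι] [Fintype κ] [Fintype τ]
    [DecidableEq ι] [DecidableEq κ] {U : Matrix ι κ ℝ} (hU : Uᵀ * U = 1) (X : Matrix ι τ ℝ) :
    frobNorm (Uᵀ * X) ≤ frobNorm X := by
  have hP : IsOrthProj (U * Uᵀ) := by
    refine ⟨by simp, ?_⟩
    rw [Matrix.mul_assoc, ← Matrix.mul_assoc Uᵀ, hU, Matrix.one_mul]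
  rw [← frobNorm_orthonormal_mul hU, ← Matrix.mul_assoc]
  exact hP.frobNorm_mul_le X

lemma frobNorm_diagonal_mul_le {κ τ : Type*} [Fintype κ] [Fintype τ] [DecidableEq κ]
    {v : κ → ℝ} {c : ℝ} (hc : 0 ≤ c) (hv : ∀ i, |v i| ≤ c) (X : Matrix κ τ ℝ) :
    frobNorm (Matrix.diagonal v * X) ≤ c * frobNorm X := by
  refine le_of_sq_le_sq ?_ (mul_nonneg hc (frobNorm_nonneg _))
  rw [mul_pow, frobNorm_sq, frobNorm_sq, frobInner_eq_sum, frobInner_eq_sum, Finset.mul_sum]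
  refine Finset.sum_le_sum fun i _ => ?_
  rw [Finset.mul_sum]
  refine Finset.sum_le_sum fun j _ => ?_
  rw [Matrix.diagonal_mul]
  have : v i ^ 2 ≤ c ^ 2 := sq_le_sq' (abs_le.mp (hv i)).1 (abs_le.mp (hv i)).2
  nlinarith [sq_nonneg (X i j)]

lemma frobNorm_svd_sq {U : Matrix (Fin m) (Fin k) ℝ} {V : Matrix (Fin n) (Fin k) ℝ}
    (hU : Uᵀ * U = 1) (hV : Vᵀ * V = 1) (v : Fin k → ℝ) :
    frobNorm (U * Matrix.diagonal v * Vᵀ) ^ 2 = ∑ i, v i ^ 2 := by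
  rw [Matrix.mul_assoc, frobNorm_orthonormal_mul hU, ← frobNorm_transpose, Matrix.transpose_mul,
    Matrix.transpose_transpose, frobNorm_orthonormal_mul hV, Matrix.diagonal_transpose,
    frobNorm_sq, frobInner_eq_sum]
  refine Finset.sum_congr rfl fun i _ => ?_
  rw [Finset.sum_eq_single i]
  · simp [sq]
  · intro j _ hj
    simp [Matrix.diagonal_apply_ne' _ hj]
  · simp

lemma exists_truncation {M : Matrix (Fin m) (Fin n) ℝ}
    {U : Matrix (Fin m) (Fin k) ℝ} {V : Matrix (Fin n) (Fin k) ℝ} {s : ℕ → ℝ}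
    (hU : Uᵀ * U = 1) (hV : Vᵀ * V = 1)
    (hM : M = U * Matrix.diagonal (fun i : Fin k => s ((i : ℕ) + 1)) * Vᵀ)
    (hpos : ∀ j, 1 ≤ j → j ≤ k → 0 < s j)
    (hanti : ∀ i j, 1 ≤ i → i ≤ j → j ≤ k → s j ≤ s i)
    {j : ℕ} (hj : 1 ≤ j) (hjk : j ≤ k) :
    ∃ (Mj R : Matrix (Fin m) (Fin n) ℝ) (K : Matrix (Fin n) (Fin m) ℝ),
      M = Mj + R ∧ Mj.rank ≤ j ∧ frobNorm M ^ 2 = frobNorm Mj ^ 2 + frobNorm R ^ 2 ∧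
      frobNorm R ^ 2 ≤ k * s (j + 1) ^ 2 ∧ s 1 ^ 2 ≤ frobNorm Mj ^ 2 ∧
      M * K * Mj = Mj ∧
      ∀ X : Matrix (Fin m) (Fin n) ℝ, s j * frobNorm (K * X) ≤ frobNorm X := by
  set a : Fin k → ℝ := fun i => if (i : ℕ) < j then s ((i : ℕ) + 1) else 0 with ha
  set b : Fin k → ℝ := fun i => if (i : ℕ) < j then 0 else s ((i : ℕ) + 1) with hb
  set c : Fin k → ℝ := fun i => if (i : ℕ) < j then (s ((i : ℕ) + 1))⁻¹ else 0 with hc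
  have hsj : 0 < s j := hpos j hj hjk
  refine ⟨U * Matrix.diagonal a * Vᵀ, U * Matrix.diagonal b * Vᵀ, V * Matrix.diagonal c * Uᵀ,
    ?_, ?_, ?_, ?_, ?_, ?_, ?_⟩
  · rw [hM, ← Matrix.add_mul, ← Matrix.mul_add, Matrix.diagonal_add]
    congr 3
    ext i
    simp only [ha, hb]
    split_ifs <;> simp
  · refine (Matrix.rank_mul_le_left _ _).trans ((Matrix.rank_mul_le_right _ _).trans ?_)
    rw [Matrix.rank_diagonal]
    refine (Fintype.card_le_of_injective
      (fun i : {i // a i ≠ 0} => (⟨(i.1 : ℕ), ?_⟩ : Fin j)) ?_).trans (by simp)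
    · by_contra hlt
      exact i.2 (by simp only [ha]; rw [if_neg hlt])
    · intro x y hxy
      simpa [Fin.ext_iff, Subtype.ext_iff] using hxy
  · rw [hM, frobNorm_svd_sq hU hV, frobNorm_svd_sq hU hV, frobNorm_svd_sq hU hV,
      ← Finset.sum_add_distrib]
    refine Finset.sum_congr rfl fun i _ => ?_
    simp only [ha, hb]
    split_ifs <;> simp
  · rw [frobNorm_svd_sq hU hV]
    refine (Finset.sum_le_card_nsmul _ _ (s (j + 1) ^ 2) fun i _ => ?_).trans (by simp)
    simp only [hb]
    split_ifs with h
    · simpa using sq_nonneg (s (j + 1))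
    · have hi := i.2
      exact pow_le_pow_left₀ (hpos _ (by omega) (by omega)).le
        (hanti _ _ (by omega) (by omega) (by omega)) 2
  · rw [frobNorm_svd_sq hU hV]
    have h0 : a ⟨0, by omega⟩ = s 1 := by
      simp only [ha]
      rw [if_pos (by omega)]
    rw [← h0]
    exact Finset.single_le_sum (f := fun i => a i ^ 2) (fun i _ => sq_nonneg _)
      (Finset.mem_univ _)
  · have h1 : M * (V * Matrix.diagonal c * Uᵀ) * (U * Matrix.diagonal a * Vᵀ) =
        U * (Matrix.diagonal (fun i : Fin k => s ((i : ℕ) + 1)) * ((Vᵀ * V) *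
          (Matrix.diagonal c * ((Uᵀ * U) * Matrix.diagonal a)))) * Vᵀ := by
      rw [hM]
      simp only [Matrix.mul_assoc]
    rw [h1, hU, hV, Matrix.one_mul, Matrix.one_mul, Matrix.diagonal_mul_diagonal,
      Matrix.diagonal_mul_diagonal]
    congr 3
    ext i
    simp only [ha, hc]
    split_ifs
    · have := hpos ((i : ℕ) + 1) (by omega) (by have := i.2; omega)
      field_simp
    · simp
  · intro X
    rw [Matrix.mul_assoc, Matrix.mul_assoc, frobNorm_orthonormal_mul hV]
    have h1 : frobNorm (Matrix.diagonal c * (Uᵀ * X)) ≤ (s j)⁻¹ * frobNorm (Uᵀ * X) := by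
      refine frobNorm_diagonal_mul_le (inv_nonneg.mpr hsj.le) (fun i => ?_) _
      simp only [hc]
      split_ifs with h
      · have hi := i.2
        have h2 := hpos ((i : ℕ) + 1) (by omega) (by omega)
        rw [abs_of_pos (inv_pos.mpr h2)]
        exact inv_anti₀ hsj (hanti _ _ (by omega) (by omega) hjk)
      · simpa using hsj.le
    have h2 := frobNorm_transpose_orthonormal_mul_le hU X
    calc s j * frobNorm (Matrix.diagonal c * (Uᵀ * X))
        ≤ s j * ((s j)⁻¹ * frobNorm (Uᵀ * X)) := by gcongr
      _ = frobNorm (Uᵀ * X) := by field_simp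
      _ ≤ frobNorm X := h2

end Truncation

section AlternatingMinimization

variable {m n d j k : ℕ} {A : Fin d → Matrix (Fin m) (Fin n) ℝ} {δ : ℝ}
  {M : Matrix (Fin m) (Fin n) ℝ}
  {U : Matrix (Fin m) (Fin j) ℝ} {V : Matrix (Fin n) (Fin j) ℝ}

lemma rank_mul_transpose_le (U : Matrix (Fin m) (Fin j) ℝ) (V : Matrix (Fin n) (Fin j) ℝ) :
    (U * Vᵀ).rank ≤ j := (Matrix.rank_mul_le_left _ _).trans (Matrix.rank_le_width U)

lemma RIP.frobNorm_proj_mul_le (h : RIP A (2 * k) δ) (hM : M.rank ≤ k) (hj : j ≤ k)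
    (hV : ∀ V' : Matrix (Fin n) (Fin j) ℝ, euclNorm (sense A (U * Vᵀ) - sense A M) ≤
      euclNorm (sense A (U * V'ᵀ) - sense A M))
    {P : Matrix (Fin m) (Fin m) ℝ} {G : Matrix (Fin j) (Fin m) ℝ}
    (hP : IsOrthProj P) (hPG : P = U * G) :
    frobNorm (P * (U * Vᵀ - M)) ≤ δ * frobNorm (U * Vᵀ - M) := by
  have hr : (U * Vᵀ - M).rank ≤ 2 * k :=
    (rank_sub_le _ _).trans (by have := rank_mul_transpose_le U V; omega)
  refine h.frobNorm_le_of_stationary (fun a b => ?_) (hP.frobInner_mul _) (fun t => ?_)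
  · have : a • (U * Vᵀ - M) + b • (P * (U * Vᵀ - M)) = (a • 1 + b • P) * (U * Vᵀ - M) := by
      rw [Matrix.add_mul, Matrix.smul_mul, Matrix.smul_mul, Matrix.one_mul]
    rw [this]
    exact (Matrix.rank_mul_le_right _ _).trans hr
  · have : U * Vᵀ - M + t • (P * (U * Vᵀ - M)) =
        U * ((Vᵀ + t • (G * (U * Vᵀ - M)))ᵀ)ᵀ - M := by
      rw [Matrix.transpose_transpose, Matrix.mul_add, Matrix.mul_smul, hPG, Matrix.mul_assoc]
      abel
    rw [this]
    exact energy_le_energy (hV _)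

lemma RIP.frobNorm_mul_proj_le (h : RIP A (2 * k) δ) (hM : M.rank ≤ k) (hj : j ≤ k)
    (hU : ∀ U' : Matrix (Fin m) (Fin j) ℝ, euclNorm (sense A (U * Vᵀ) - sense A M) ≤
      euclNorm (sense A (U' * Vᵀ) - sense A M))
    {Q : Matrix (Fin n) (Fin n) ℝ} {G : Matrix (Fin j) (Fin n) ℝ}
    (hQ : IsOrthProj Q) (hQG : Q = V * G) :
    frobNorm ((U * Vᵀ - M) * Q) ≤ δ * frobNorm (U * Vᵀ - M) := by
  have hr : (U * Vᵀ - M).rank ≤ 2 * k :=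
    (rank_sub_le _ _).trans (by have := rank_mul_transpose_le U V; omega)
  have hQG' : Q = Gᵀ * Vᵀ := by rw [← Matrix.transpose_mul, ← hQG, hQ.1]
  refine h.frobNorm_le_of_stationary (fun a b => ?_) (hQ.frobInner_mul' _) (fun t => ?_)
  · have : a • (U * Vᵀ - M) + b • ((U * Vᵀ - M) * Q) = (U * Vᵀ - M) * (a • 1 + b • Q) := by
      rw [Matrix.mul_add, Matrix.mul_smul, Matrix.mul_smul, Matrix.mul_one]
    rw [this]
    exact (Matrix.rank_mul_le_left _ _).trans hr
  · have : U * Vᵀ - M + t • ((U * Vᵀ - M) * Q) =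
        (U + t • ((U * Vᵀ - M) * Gᵀ)) * Vᵀ - M := by
      rw [Matrix.add_mul, Matrix.smul_mul, Matrix.mul_assoc _ Gᵀ, ← hQG']
      abel
    rw [this]
    exact energy_le_energy (hU _)

lemma RIP.energy_le_of_left_opt (h : RIP A (2 * k) δ) (hM : M.rank ≤ k)
    (hV : ∀ V' : Matrix (Fin n) (Fin j) ℝ, euclNorm (sense A (U * Vᵀ) - sense A M) ≤
      euclNorm (sense A (U * V'ᵀ) - sense A M))
    {P : Matrix (Fin m) (Fin m) ℝ} {G : Matrix (Fin j) (Fin m) ℝ} (hPG : P = U * G) :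
    energy A (U * Vᵀ - M) ≤ (1 + δ) * frobNorm ((1 - P) * M) ^ 2 := by
  have h1 := energy_le_energy (hV (G * M)ᵀ)
  have h2 : U * ((G * M)ᵀ)ᵀ - M = -((1 - P) * M) := by
    rw [Matrix.transpose_transpose, hPG, Matrix.sub_mul, Matrix.one_mul, Matrix.mul_assoc, neg_sub]
  rw [h2, energy_neg] at h1
  exact h1.trans (h.energy_le ((Matrix.rank_mul_le_right _ _).trans (by omega)))

lemma RIP.energy_le_of_right_opt (h : RIP A (2 * k) δ) (hM : M.rank ≤ k)
    (hU : ∀ U' : Matrix (Fin m) (Fin j) ℝ, euclNorm (sense A (U * Vᵀ) - sense A M) ≤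
      euclNorm (sense A (U' * Vᵀ) - sense A M))
    {Q : Matrix (Fin n) (Fin n) ℝ} {G : Matrix (Fin j) (Fin n) ℝ}
    (hQ : IsOrthProj Q) (hQG : Q = V * G) :
    energy A (U * Vᵀ - M) ≤ (1 + δ) * frobNorm (M * (1 - Q)) ^ 2 := by
  have hQG' : Q = Gᵀ * Vᵀ := by rw [← Matrix.transpose_mul, ← hQG, hQ.1]
  have h1 := energy_le_energy (hU (M * Gᵀ))
  have h2 : M * Gᵀ * Vᵀ - M = -(M * (1 - Q)) := by
    rw [Matrix.mul_sub, Matrix.mul_one, hQG', neg_sub, Matrix.mul_assoc]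
  rw [h2, energy_neg] at h1
  exact h1.trans (h.energy_le ((Matrix.rank_mul_le_left _ _).trans (by omega)))

/-- The row space `Q` found by least squares from an accurate column space `P` is accurate. -/
lemma frobNorm_mul_compl_le {Mj R : Matrix (Fin m) (Fin n) ℝ} {K : Matrix (Fin n) (Fin m) ℝ}
    {σ η : ℝ} (hMj : M = Mj + R) (hK : M * K * Mj = Mj)
    (hKσ : ∀ X : Matrix (Fin m) (Fin n) ℝ, σ * frobNorm (K * X) ≤ frobNorm X)
    {P : Matrix (Fin m) (Fin m) ℝ} {Q : Matrix (Fin n) (Fin n) ℝ}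
    (hP : IsOrthProj P) (hQ : IsOrthProj Q) {X : Matrix (Fin m) (Fin n) ℝ}
    (hXQ : X * Q = X) (hη : frobNorm (P * (X - M)) ≤ η)
    (hacc : frobNorm ((1 - P) * M) ≤ σ / 2) :
    frobNorm (M * (1 - Q)) ≤ 6 / 5 * (η + frobNorm R) + frobNorm R := by
  set B := Mj * (1 - Q) with hB
  have h1 : P * B = -(P * (X - M) * (1 - Q)) - P * (R * (1 - Q)) := by
    have hX0 : X * (1 - Q) = 0 := by rw [Matrix.mul_sub, hXQ, Matrix.mul_one, sub_self]
    rw [hB, Matrix.mul_assoc P (X - M), Matrix.sub_mul, hX0, hMj, Matrix.add_mul]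
    simp [Matrix.mul_add]
  have h2 : frobNorm (P * B) ≤ η + frobNorm R := by
    rw [h1]
    refine (frobNorm_sub_le _ _).trans ?_
    rw [frobNorm_neg]
    exact add_le_add ((hQ.compl.frobNorm_mul_le' _).trans hη)
      ((hP.frobNorm_mul_le _).trans (hQ.compl.frobNorm_mul_le' _))
  have h3 : frobNorm ((1 - P) * B) ≤ frobNorm B / 2 := by
    have h4 : (1 - P) * B = (1 - P) * M * (K * B) := by
      rw [hB, ← Matrix.mul_assoc K, Matrix.mul_assoc (1 - P), ← Matrix.mul_assoc M,
        ← Matrix.mul_assoc M, hK]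
    rw [h4]
    refine (AltMin.frobNorm_mul_le _ _).trans ?_
    have := mul_le_mul_of_nonneg_right hacc (frobNorm_nonneg (K * B))
    linarith [hKσ B]
  have h5 := hP.pythagoras B
  have h6 : frobNorm B ≤ 6 / 5 * frobNorm (P * B) := by
    have h7 := pow_le_pow_left₀ (frobNorm_nonneg _) h3 2
    refine le_of_sq_le_sq ?_ (by linarith [frobNorm_nonneg (P * B)])
    nlinarith [sq_nonneg (frobNorm (P * B))]
  have h8 : M * (1 - Q) = B + R * (1 - Q) := by rw [hB, hMj, Matrix.add_mul]
  rw [h8]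
  refine (frobNorm_add_le _ _).trans ?_
  linarith [hQ.compl.frobNorm_mul_le' R]

lemma RIP.energy_altMin_step_le (h : RIP A (2 * k) δ) (hδ : 0 ≤ δ) (hδ' : δ ≤ 1 / 3200)
    (hM : M.rank ≤ k) (hj : j ≤ k)
    {Mj R : Matrix (Fin m) (Fin n) ℝ} {K : Matrix (Fin n) (Fin m) ℝ} {σ r : ℝ}
    (hMj : M = Mj + R) (hK : M * K * Mj = Mj)
    (hKσ : ∀ X : Matrix (Fin m) (Fin n) ℝ, σ * frobNorm (K * X) ≤ frobNorm X)
    (hR : frobNorm R ^ 2 ≤ r)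
    {U' : Matrix (Fin m) (Fin j) ℝ} {V' : Matrix (Fin n) (Fin j) ℝ}
    (hV : ∀ W : Matrix (Fin n) (Fin j) ℝ, euclNorm (sense A (U * V'ᵀ) - sense A M) ≤
      euclNorm (sense A (U * Wᵀ) - sense A M))
    (hU : ∀ W : Matrix (Fin m) (Fin j) ℝ, euclNorm (sense A (U' * V'ᵀ) - sense A M) ≤
      euclNorm (sense A (W * V'ᵀ) - sense A M))
    {P : Matrix (Fin m) (Fin m) ℝ} {G : Matrix (Fin j) (Fin m) ℝ}
    (hP : IsOrthProj P) (hPG : P = U * G) (hacc : frobNorm ((1 - P) * M) ≤ σ / 2) :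
    energy A (U' * V'ᵀ - M) ≤ max (energy A (U * Vᵀ - M) / 2) ((1 - δ) * (16 * r)) := by
  obtain ⟨Q, H, hQ, hQV, hQH⟩ := exists_isOrthProj V'
  have hXQ : U * V'ᵀ * Q = U * V'ᵀ := by
    rw [Matrix.mul_assoc]
    congr 1
    rw [← Matrix.transpose_transpose (V'ᵀ * Q), Matrix.transpose_mul, Matrix.transpose_transpose,
      hQ.1, hQV]
  have h1 := h.frobNorm_proj_mul_le hM hj hV hP hPG
  have h2 := frobNorm_mul_compl_le hMj hK hKσ hP hQ hXQ h1 hacc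
  have h3 := h.energy_le_of_right_opt hM hU hQ hQH
  have h4 := h.le_energy (X := U * V'ᵀ - M)
    ((rank_sub_le _ _).trans (by have := rank_mul_transpose_le U V'; omega))
  have h5 := energy_le_energy (hV V)
  have h6 := pow_le_pow_left₀ (frobNorm_nonneg _) h2 2
  have hx := frobNorm_nonneg (U * V'ᵀ - M)
  have hp := frobNorm_nonneg R
  set x := frobNorm (U * V'ᵀ - M)
  set p := frobNorm R
  set y := frobNorm (M * (1 - Q)) ^ 2
  have hδx : δ * x ≤ 1 / 3200 * x := mul_le_mul_of_nonneg_right hδ' hx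
  have hδx0 : 0 ≤ δ * x := mul_nonneg hδ hx
  have hy0 : 0 ≤ y := sq_nonneg _
  rcases le_total p (x / 4) with hpx | hpx
  · refine le_max_of_le_left ?_
    have h7 : y ≤ (0.56 * x) ^ 2 := h6.trans (pow_le_pow_left₀ (by positivity) (by linarith) 2)
    nlinarith [sq_nonneg x]
  · refine le_max_of_le_right ?_
    have h7 : y ≤ (2.21 * p) ^ 2 := h6.trans (pow_le_pow_left₀ (by positivity) (by linarith) 2)
    nlinarith [sq_nonneg p]

lemma RIP.energy_altMin_le (h : RIP A (2 * k) δ) (hδ : 0 ≤ δ) (hδ' : δ ≤ 1 / 3200)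
    (hM : M.rank ≤ k) (hj : j ≤ k)
    {Mj R : Matrix (Fin m) (Fin n) ℝ} {K : Matrix (Fin n) (Fin m) ℝ} {σ r w : ℝ}
    (hMj : M = Mj + R) (hK : M * K * Mj = Mj) (hσ : 0 < σ)
    (hKσ : ∀ X : Matrix (Fin m) (Fin n) ℝ, σ * frobNorm (K * X) ≤ frobNorm X)
    (hR : frobNorm R ^ 2 ≤ r)
    {U : ℕ → Matrix (Fin m) (Fin j) ℝ} {V : ℕ → Matrix (Fin n) (Fin j) ℝ}
    (hV : ∀ t, ∀ W : Matrix (Fin n) (Fin j) ℝ,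
      euclNorm (sense A (U t * (V (t + 1))ᵀ) - sense A M) ≤
        euclNorm (sense A (U t * Wᵀ) - sense A M))
    (hU : ∀ t, ∀ W : Matrix (Fin m) (Fin j) ℝ,
      euclNorm (sense A (U (t + 1) * (V (t + 1))ᵀ) - sense A M) ≤
        euclNorm (sense A (W * (V (t + 1))ᵀ) - sense A M))
    (hw : w ≤ σ / 100)
    (hinit : ∀ P : Matrix (Fin m) (Fin m) ℝ, IsOrthProj P → P * U 0 = U 0 →
      frobNorm ((1 - P) * M) ≤ 5 / 3 * (frobNorm R + w)) (T : ℕ) (hT : 1 ≤ T) :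
    energy A (U T * (V T)ᵀ - M) ≤
      max ((1 / 2) ^ T * energy A (U 0 * (V 0)ᵀ - M)) ((1 - δ) * (16 * r)) := by
  have hmono : Antitone fun t => energy A (U t * (V t)ᵀ - M) :=
    antitone_nat_of_succ_le fun t =>
      (energy_le_energy (hU t (U t))).trans (energy_le_energy (hV t (V t)))
  obtain ⟨P₀, G₀, hP₀, hPU₀, hPG₀⟩ := exists_isOrthProj (U 0)
  have hacc₀ := hinit P₀ hP₀ hPU₀
  have hone : energy A (U 1 * (V 1)ᵀ - M) ≤ (1 + δ) * frobNorm ((1 - P₀) * M) ^ 2 :=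
    (energy_le_energy (hU 0 (U 0))).trans (h.energy_le_of_left_opt hM (hV 0) hPG₀)
  have hp := frobNorm_nonneg R
  have hsq := pow_le_pow_left₀ (frobNorm_nonneg _) hacc₀ 2
  rcases le_total w (frobNorm R) with hwR | hwR
  · refine le_max_of_le_right (((hmono hT).trans hone).trans ?_)
    have h1 : frobNorm ((1 - P₀) * M) ^ 2 ≤ (10 / 3 * frobNorm R) ^ 2 :=
      pow_le_pow_left₀ (frobNorm_nonneg _) (by linarith) 2
    nlinarith [sq_nonneg (frobNorm R)]
  · have h1 : frobNorm ((1 - P₀) * M) ≤ σ / 30 := by linarith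
    have h2 : frobNorm ((1 - P₀) * M) ^ 2 ≤ (σ / 30) ^ 2 :=
      pow_le_pow_left₀ (frobNorm_nonneg _) h1 2
    have hacc : ∀ t, ∃ (P : Matrix (Fin m) (Fin m) ℝ) (G : Matrix (Fin j) (Fin m) ℝ),
        IsOrthProj P ∧ P = U t * G ∧ frobNorm ((1 - P) * M) ≤ σ / 2 := by
      intro t
      rcases Nat.eq_zero_or_pos t with rfl | ht
      · exact ⟨P₀, G₀, hP₀, hPG₀, by linarith⟩
      obtain ⟨P, G, hP, hPU, hPG⟩ := exists_isOrthProj (U t)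
      refine ⟨P, G, hP, hPG, ?_⟩
      have h3 : (1 - P) * M = -((1 - P) * (U t * (V t)ᵀ - M)) := by
        rw [Matrix.mul_sub, ← Matrix.mul_assoc, Matrix.sub_mul 1 P (U t), hPU]
        simp
      have h4 := hP.compl.frobNorm_mul_le (U t * (V t)ᵀ - M)
      have h5 := h.le_energy (X := U t * (V t)ᵀ - M)
        ((rank_sub_le _ _).trans (by have := rank_mul_transpose_le (U t) (V t); omega))
      have h6 : energy A (U t * (V t)ᵀ - M) ≤ _ := (hmono ht).trans hone
      rw [h3, frobNorm_neg]
      refine h4.trans (le_of_sq_le_sq ?_ (by linarith))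
      nlinarith [sq_nonneg (frobNorm (U t * (V t)ᵀ - M)), sq_nonneg σ]
    have hind : ∀ t, energy A (U t * (V t)ᵀ - M) ≤
        max ((1 / 2) ^ t * energy A (U 0 * (V 0)ᵀ - M)) ((1 - δ) * (16 * r)) := by
      intro t
      induction t with
      | zero => simp
      | succ t ih =>
        obtain ⟨P, G, hP, hPG, hPM⟩ := hacc t
        have h3 := h.energy_altMin_step_le hδ hδ' hM hj hMj hK hKσ hR (V := V t)
          (hV t) (hU t) hP hPG hPM
        rcases le_max_iff.mp h3 with h4 | h4
        · rcases le_max_iff.mp ih with h5 | h5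
          · refine le_max_of_le_left ?_
            rw [pow_succ]
            linarith
          · refine le_max_of_le_right ?_
            have : 0 ≤ energy A (U t * (V t)ᵀ - M) := sq_nonneg _
            linarith
        · exact le_max_of_le_right h4
    exact hind T

end AlternatingMinimization

set_option maxHeartbeats 800000 in
/-- Theorem: Stage-AltMin for matrix sensing: there is an absolute constant
`c > 0` such that, under `2k`-RIP with `δ_{2k} < 1/(3200k²)`, running `T ≥ c·log(‖M‖_F²/ε)`
alternating steps per stage, every stage `i` of Stage-AltMin satisfies
`‖M − Û^T_{1:i}(V̂^T_{1:i})ᵀ‖_F² ≤ max(ε, 16k(σ*_{i+1})²)`; in particular stage `k` has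
squared error at most `ε`. (Here `s j` denotes `σ*_j`, with `s j = 0` for `j > k`.) -/
theorem stageAltMin_main :
    ∃ c : ℝ, 0 < c ∧
      ∀ (m n d k T : ℕ), 0 < k →
      ∀ (A : Fin d → Matrix (Fin m) (Fin n) ℝ)
        (M : Matrix (Fin m) (Fin n) ℝ)
        (Ustar : Matrix (Fin m) (Fin k) ℝ) (Vstar : Matrix (Fin n) (Fin k) ℝ)
        (s : ℕ → ℝ) (μ δ ε : ℝ),
        Ustarᵀ * Ustar = 1 → Vstarᵀ * Vstar = 1 →
        M = Ustar * Matrix.diagonal (fun i : Fin k => s ((i : ℕ) + 1)) * Vstarᵀ →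
        M.rank = k →
        (∀ j, 1 ≤ j → j ≤ k → 0 < s j) →
        (∀ i j, 1 ≤ i → i ≤ j → j ≤ k → s j ≤ s i) →
        (∀ j, k < j → s j = 0) →
        -- incoherence of `M`
        (∀ i, euclNorm (fun q => Ustar i q) ≤ μ * Real.sqrt k / Real.sqrt m) →
        (∀ j, euclNorm (fun q => Vstar j q) ≤ μ * Real.sqrt k / Real.sqrt n) →
        RIP A (2 * k) δ →
        δ < 1 / (3200 * (k : ℝ) ^ 2) →
        0 < ε →
        c * Real.log (frobNorm M ^ 2 / ε) ≤ (T : ℝ) →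
        ∀ (Uh : (i : ℕ) → ℕ → Matrix (Fin m) (Fin i) ℝ)
          (Vh : (i : ℕ) → ℕ → Matrix (Fin n) (Fin i) ℝ),
          -- stage `i+1` is initialized by one step of SVP from the output of stage `i`
          (∀ i, i < k →
            IsBestRankApprox
              (Uh i T * (Vh i T)ᵀ -
                (3 / 4 : ℝ) • senseAdj A (sense A (Uh i T * (Vh i T)ᵀ) - sense A M))
              (Uh (i + 1) 0 * (Vh (i + 1) 0)ᵀ) (i + 1)) →
          -- alternating least-squares steps within each stage
          (∀ i, 1 ≤ i → i ≤ k → ∀ t, ∀ V : Matrix (Fin n) (Fin i) ℝ,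
            euclNorm (sense A (Uh i t * (Vh i (t + 1))ᵀ) - sense A M)
              ≤ euclNorm (sense A (Uh i t * Vᵀ) - sense A M)) →
          (∀ i, 1 ≤ i → i ≤ k → ∀ t, ∀ U : Matrix (Fin m) (Fin i) ℝ,
            euclNorm (sense A (Uh i (t + 1) * (Vh i (t + 1))ᵀ) - sense A M)
              ≤ euclNorm (sense A (U * (Vh i (t + 1))ᵀ) - sense A M)) →
          (∀ i, 1 ≤ i → i ≤ k →
            frobNorm (M - Uh i T * (Vh i T)ᵀ) ^ 2 ≤ max ε (16 * k * s (i + 1) ^ 2)) ∧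
          frobNorm (M - Uh k T * (Vh k T)ᵀ) ^ 2 ≤ ε := by
  refine ⟨2, two_pos, ?_⟩
  intro m n d k T hk A M Ustar Vstar s μ δ ε hU hV hM hrank hpos hanti hzero _ _ hrip hδk hε hT
    Uh Vh hinit hVopt hUopt
  have hk1 : (1 : ℝ) ≤ k := by exact_mod_cast hk
  have hMr : M.rank ≤ k := hrank.le
  set N := frobNorm M ^ 2 with hN
  obtain ⟨M₁, R₁, -, hM₁, hM₁r, hM₁N, hR₁, hs₁, -, -⟩ :=
    exists_truncation hU hV hM hpos hanti le_rfl hk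
  have hs1 : 0 < s 1 := hpos 1 le_rfl hk
  have hs21 : s 2 ^ 2 ≤ s 1 ^ 2 := by
    rcases lt_or_ge k 2 with h | h
    · rw [hzero 2 h]
      nlinarith [sq_nonneg (s 1)]
    · exact pow_le_pow_left₀ (hpos 2 one_le_two h).le (hanti 1 2 le_rfl one_le_two h) 2
  have hR₁' : frobNorm R₁ ^ 2 ≤ k * frobNorm M₁ ^ 2 :=
    hR₁.trans (mul_le_mul_of_nonneg_left (hs21.trans hs₁) (by positivity))
  have hNpos : 0 < N := by
    rw [hN, hM₁N]
    nlinarith [sq_nonneg (frobNorm R₁), sq_pos_of_pos hs1]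
  have hδ : 0 ≤ δ := by
    have h1 := (hrip.le_energy (X := M) (by omega)).trans (hrip.energy_le (X := M) (by omega))
    rw [← hN] at h1
    nlinarith
  have hδk2 : δ * k ^ 2 ≤ 1 / 3200 := by
    have := mul_le_mul_of_nonneg_right hδk.le (sq_nonneg (k : ℝ))
    have h2 : 1 / (3200 * (k : ℝ) ^ 2) * (k : ℝ) ^ 2 = 1 / 3200 := by field_simp
    linarith
  have hδk1 : δ * k ≤ 1 / 3200 := by nlinarith [mul_nonneg hδ (by linarith : (0 : ℝ) ≤ k)]
  have hδ' : δ ≤ 1 / 3200 := by nlinarith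
  -- the residual never increases
  have hstep : ∀ i, 1 ≤ i → i ≤ k → ∀ t,
      energy A (Uh i t * (Vh i t)ᵀ - M) ≤ energy A (Uh i 0 * (Vh i 0)ᵀ - M) := by
    intro i hi hik t
    have : Antitone fun t => energy A (Uh i t * (Vh i t)ᵀ - M) :=
      antitone_nat_of_succ_le fun t =>
        (energy_le_energy (hUopt i hi hik t (Uh i t))).trans
          (energy_le_energy (hVopt i hi hik t (Vh i t)))
    exact this (Nat.zero_le t)
  have hrk : ∀ i t, (Uh i t * (Vh i t)ᵀ).rank ≤ i := fun i t => rank_mul_transpose_le _ _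
  have hstage : ∀ i, i < k → energy A (Uh (i + 1) 0 * (Vh (i + 1) 0)ᵀ - M) ≤
      energy A (Uh i T * (Vh i T)ᵀ - M) := by
    intro i hi
    have := (hinit i hi).svp_energy_le hrip (by linarith) ((hrk i T).trans (by omega))
      ((hrk i T).trans hi.le) (by omega)
    simpa [frobNorm_zero] using this
  have hfirst : energy A (Uh 1 0 * (Vh 1 0)ᵀ - M) ≤ (1 - δ) * N := by
    have h1 := (hinit 0 hk).svp_energy_le hrip (by linarith) (W := M₁) (by simpa using hM₁r)
      ((hrk 0 T).trans (by omega)) (by omega)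
    have h0 : Uh 0 T * (Vh 0 T)ᵀ = 0 := by
      ext a b
      simp [Matrix.mul_apply]
    have h2 : M₁ - M = -R₁ := by rw [hM₁]; abel
    have h3 : R₁.rank ≤ 2 * k := by
      have : R₁ = M - M₁ := by rw [hM₁]; abel
      rw [this]
      exact (rank_sub_le _ _).trans (by omega)
    rw [h0, sub_zero, h2, energy_neg] at h1
    have h4 := hrip.energy_le h3
    have h5 : δ * frobNorm R₁ ^ 2 ≤ 1 / 3200 * frobNorm M₁ ^ 2 := by
      have h6 := mul_le_mul_of_nonneg_left hR₁' hδ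
      have h7 := mul_le_mul_of_nonneg_right hδk1 (sq_nonneg (frobNorm M₁))
      linarith
    have h8 := mul_le_mul_of_nonneg_right hδ' (sq_nonneg (frobNorm M₁))
    refine h1.trans ?_
    rw [hN, hM₁N]
    linarith [sq_nonneg (frobNorm M₁)]
  have hglobal : ∀ i, i < k → energy A (Uh (i + 1) 0 * (Vh (i + 1) 0)ᵀ - M) ≤ (1 - δ) * N := by
    intro i
    induction i with
    | zero => exact fun _ => hfirst
    | succ i ih =>
      intro hi
      exact (hstage (i + 1) hi).trans
        ((hstep (i + 1) (by omega) hi.le T).trans (ih (by omega)))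
  have hconv : ∀ i, i ≤ k → ∀ x : ℝ, energy A (Uh i T * (Vh i T)ᵀ - M) ≤ (1 - δ) * x →
      frobNorm (Uh i T * (Vh i T)ᵀ - M) ^ 2 ≤ x := by
    intro i hi x hx
    have h1 := hrip.le_energy (X := Uh i T * (Vh i T)ᵀ - M)
      ((rank_sub_le _ _).trans (by have := hrk i T; omega))
    exact le_of_mul_le_mul_left (h1.trans hx) (by linarith)
  have hpow : (1 / 2 : ℝ) ^ T * N ≤ ε := by
    have h1 : Real.log (N / ε) ≤ T * Real.log 2 := by
      have := Real.log_two_gt_d9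
      nlinarith [(Nat.cast_nonneg T : (0 : ℝ) ≤ T)]
    rw [← Real.log_pow] at h1
    have h2 := (Real.log_le_log_iff (div_pos hNpos hε) (by positivity)).mp h1
    rw [div_le_iff₀ hε] at h2
    rw [one_div, inv_pow, inv_mul_le_iff₀ (by positivity)]
    exact h2
  have hmain : ∀ i, i ≤ k → (1 ≤ i ∨ ε < N) → energy A (Uh i T * (Vh i T)ᵀ - M) ≤
      (1 - δ) * max ε (16 * k * s (i + 1) ^ 2) := by
    rcases le_or_gt N ε with hNε | hNε
    · intro i hik hi
      rcases hi with hi | hi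
      · obtain ⟨i, rfl⟩ : ∃ l, i = l + 1 := ⟨i - 1, by omega⟩
        refine ((hstep _ hi hik T).trans (hglobal i hik)).trans ?_
        exact mul_le_mul_of_nonneg_left (hNε.trans (le_max_left _ _)) (by linarith)
      · exact absurd hi (not_lt.mpr hNε)
    have hT1 : 1 ≤ T := by
      by_contra h0
      have hT0 : T = 0 := by omega
      rw [hT0, pow_zero, one_mul] at hpow
      linarith
    suffices h : ∀ i, i ≤ k → energy A (Uh i T * (Vh i T)ᵀ - M) ≤
        (1 - δ) * max ε (16 * k * s (i + 1) ^ 2) from fun i hik _ => h i hik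
    intro i
    induction i with
    | zero =>
      intro _
      have h0 : Uh 0 T * (Vh 0 T)ᵀ = 0 := by
        ext a b
        simp [Matrix.mul_apply]
      have hNs : N ≤ k * s 1 ^ 2 := by
        rw [hN, hM, frobNorm_svd_sq hU hV]
        refine (Finset.sum_le_card_nsmul _ _ (s 1 ^ 2) fun i _ => ?_).trans (by simp)
        have hi := i.2
        exact pow_le_pow_left₀ (hpos _ (by omega) (by omega)).le
          (hanti _ _ le_rfl (by omega) (by omega)) 2
      rw [h0, zero_sub, energy_neg]
      refine (hrip.energy_le (X := M) (by omega)).trans ?_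
      refine le_trans ?_ (mul_le_mul_of_nonneg_left (le_max_right _ _) (by linarith))
      rw [← hN]
      simp only [zero_add]
      nlinarith
    | succ i ih =>
      intro hi
      have hprev := ih (by omega)
      rcases le_total (16 * k * s (i + 1) ^ 2) ε with hcase | hcase
      · rw [max_eq_left hcase] at hprev
        refine (((hstep (i + 1) (by omega) hi T).trans (hstage i hi)).trans hprev).trans ?_
        exact mul_le_mul_of_nonneg_left (le_max_left _ _) (by linarith)
      rw [max_eq_right hcase] at hprev
      have herr := hconv i (by omega) _ hprev
      have hσ : 0 < s (i + 1) := hpos _ (by omega) hi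
      obtain ⟨Mj, R, K, hMj, hMjr, -, hR, -, hK, hKσ⟩ :=
        exists_truncation hU hV hM hpos hanti (j := i + 1) (by omega) hi
      obtain ⟨Q, hQ, hXQ, hEQ⟩ : ∃ Q : Matrix (Fin n) (Fin n) ℝ, IsOrthProj Q ∧
          Uh i T * (Vh i T)ᵀ * Q = Uh i T * (Vh i T)ᵀ ∧
          frobNorm ((Uh i T * (Vh i T)ᵀ - M) * Q) ≤
            δ * frobNorm (Uh i T * (Vh i T)ᵀ - M) := by
        rcases Nat.eq_zero_or_pos i with rfl | hi0
        · refine ⟨0, ⟨by simp, by simp⟩, ?_, ?_⟩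
          · ext a b
            simp [Matrix.mul_apply]
          · rw [Matrix.mul_zero, frobNorm_zero]
            exact mul_nonneg hδ (frobNorm_nonneg _)
        · obtain ⟨t, rfl⟩ : ∃ t, T = t + 1 := ⟨T - 1, by omega⟩
          obtain ⟨Q, G, hQ, hQV, hQG⟩ := exists_isOrthProj (Vh i (t + 1))
          refine ⟨Q, hQ, ?_, hrip.frobNorm_mul_proj_le hMr (by omega)
            (hUopt i hi0 (by omega) t) hQ hQG⟩
          have : (Vh i (t + 1))ᵀ * Q = (Vh i (t + 1))ᵀ := by
            conv_rhs => rw [← hQV, Matrix.transpose_mul, hQ.1]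
          rw [Matrix.mul_assoc, this]
      have hw : 8 * δ * frobNorm (Uh i T * (Vh i T)ᵀ - M) ≤ s (i + 1) / 100 := by
        refine le_of_sq_le_sq ?_ (by positivity)
        have h1 : δ * (δ * k) ≤ 1 / 3200 * (1 / 3200) := by gcongr
        have h2 := mul_le_mul_of_nonneg_left herr (sq_nonneg δ)
        have h3 := mul_le_mul_of_nonneg_right h1 (sq_nonneg (s (i + 1)))
        nlinarith
      have hst := hrip.energy_altMin_le hδ hδ' hMr hi hMj hK hσ hKσ hR
        (hVopt (i + 1) (by omega) hi) (hUopt (i + 1) (by omega) hi) hw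
        (fun P hP hPU => (hinit i hi).svp_frobNorm_le hrip hδ ((hrk i T).trans (by omega)) hMr hi
          hMj hMjr hQ hXQ hEQ hP (by rw [← Matrix.mul_assoc, hPU])) T hT1
      refine hst.trans (max_le ?_ ?_)
      · have h1 := mul_le_mul_of_nonneg_left (hglobal i hi)
          (by positivity : (0 : ℝ) ≤ (1 / 2) ^ T)
        have h2 := mul_le_mul_of_nonneg_left hpow (by linarith : 0 ≤ 1 - δ)
        have h3 := mul_le_mul_of_nonneg_left (le_max_left ε (16 * k * s (i + 1 + 1) ^ 2))
          (by linarith : 0 ≤ 1 - δ)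
        linarith
      · refine mul_le_mul_of_nonneg_left ?_ (by linarith)
        rw [← mul_assoc]
        exact le_max_right _ _
  have hfinal : ∀ i, 1 ≤ i → i ≤ k →
      frobNorm (M - Uh i T * (Vh i T)ᵀ) ^ 2 ≤ max ε (16 * k * s (i + 1) ^ 2) := by
    intro i hi hik
    rw [← frobNorm_neg, neg_sub]
    exact hconv i hik _ (hmain i hik (Or.inl hi))
  refine ⟨hfinal, ?_⟩
  have := hfinal k hk le_rfl
  rwa [hzero (k + 1) (by omega), zero_pow two_ne_zero, mul_zero, max_eq_left hε.le] at this

end AltMin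
end
end

section
/- Let Û^t ∈ ℝ^{m×k} and Ũ^t ∈ ℝ^{m×k} be two full-column-rank matrices spanning the same column space, with QR factor Ũ^t = U^t R_U^t, and let V̂^{t+1} = argmin_{V ∈ ℝ^{n×k}} ‖𝒜(Û^t Vᵀ) − b‖₂² and Ṽ^{t+1} = argmin_{V ∈ ℝ^{n×k}} ‖𝒜(U^t Vᵀ) − b‖₂². Assume Ṽ^{t+1} is unique and has full column rank (which holds whenever dist(Ṽ^{t+1}, V*) < 1 in the setting of the sensing convergence theorem). Then V̂^{t+1} is unique, has full column rank, and Span(V̂^{t+1}) = Span(Ṽ^{t+1}); in particular V̂^{t+1} = Ṽ^{t+1}((R_U^t R)ᵀ)^{−1} where Û^t = Ũ^t R. -/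
open Matrix MeasureTheory Finset

noncomputable section

namespace AltMin

/-- The column-span projection is invariant under an invertible change of basis. -/
theorem colProj_mul_of_isUnit_det {m k : ℕ} (W : Matrix (Fin m) (Fin k) ℝ)
    {S : Matrix (Fin k) (Fin k) ℝ} (hS : IsUnit S.det) : colProj (W * S) = colProj W := by
  have hSt : IsUnit Sᵀ.det := by rwa [det_transpose]
  unfold colProj
  have hgram : (W * S)ᵀ * (W * S) = Sᵀ * ((Wᵀ * W) * S) := by
    simp only [transpose_mul, Matrix.mul_assoc]
  rw [hgram, Matrix.mul_inv_rev, Matrix.mul_inv_rev, transpose_mul]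
  calc W * S * (S⁻¹ * (Wᵀ * W)⁻¹ * Sᵀ⁻¹) * (Sᵀ * Wᵀ)
      = W * (S * S⁻¹) * (Wᵀ * W)⁻¹ * (Sᵀ⁻¹ * Sᵀ) * Wᵀ := by simp only [Matrix.mul_assoc]
    _ = W * (Wᵀ * W)⁻¹ * Wᵀ := by
      rw [mul_nonsing_inv _ hS, nonsing_inv_mul _ hSt, Matrix.mul_one, Matrix.mul_one]

/-- A square right factor of a product of full column rank is invertible. -/
theorem isUnit_det_of_rank_mul_eq {m k : ℕ} {W : Matrix (Fin m) (Fin k) ℝ}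
    {S : Matrix (Fin k) (Fin k) ℝ} (h : (W * S).rank = k) : IsUnit S.det := by
  have hk : S.rank = k := le_antisymm (rank_le_width S) (h.symm.le.trans (rank_mul_le_right W S))
  rw [← isUnit_iff_isUnit_det, ← linearIndependent_cols_iff_isUnit,
    linearIndependent_iff_card_eq_finrank_span, Fintype.card_fin, Set.finrank,
    ← rank_eq_finrank_span_cols, hk]

/-- Lemma: invariance of the alternating-minimization iterate under change of
basis of the previous iterate: if `Û^t = Ũ^t R` and `Ũ^t = U^t R_U` (QR) span the same space,
and the least-squares update `Ṽ^{t+1}` w.r.t. the orthonormal `U^t` is unique with full column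
rank, then the update `V̂^{t+1}` w.r.t. `Û^t` is unique, has full column rank, spans the same
space as `Ṽ^{t+1}`, and equals `Ṽ^{t+1} ((R_U R)ᵀ)⁻¹`. -/
theorem qr_irrelevance
    (m n d k : ℕ)
    (A : Fin d → Matrix (Fin m) (Fin n) ℝ) (b : Fin d → ℝ)
    (Uhat Util Ut : Matrix (Fin m) (Fin k) ℝ)
    (RU R : Matrix (Fin k) (Fin k) ℝ)
    -- `Û^t`, `Ũ^t` have full column rank and span the same column space
    (hUhat_rank : Uhat.rank = k) (hUtil_rank : Util.rank = k)
    (hspan : colProj Uhat = colProj Util)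
    -- QR factorization `Ũ^t = U^t R_U`
    (hQR : Util = Ut * RU) (hUt : Utᵀ * Ut = 1)
    (hRUtri : ∀ i j : Fin k, j < i → RU i j = 0)
    -- `Û^t = Ũ^t R`
    (hR : Uhat = Util * R) (hRunit : IsUnit R.det)
    (Vhat Vtil : Matrix (Fin n) (Fin k) ℝ)
    -- `V̂^{t+1} = argmin_V ‖𝒜(Û^t Vᵀ) − b‖₂²`
    (hVhat : ∀ V : Matrix (Fin n) (Fin k) ℝ,
      euclNorm (sense A (Uhat * Vhatᵀ) - b) ≤ euclNorm (sense A (Uhat * Vᵀ) - b))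
    -- `Ṽ^{t+1} = argmin_V ‖𝒜(U^t Vᵀ) − b‖₂²`, unique, full column rank
    (hVtil : ∀ V : Matrix (Fin n) (Fin k) ℝ,
      euclNorm (sense A (Ut * Vtilᵀ) - b) ≤ euclNorm (sense A (Ut * Vᵀ) - b))
    (hVtil_unique : ∀ V : Matrix (Fin n) (Fin k) ℝ,
      euclNorm (sense A (Ut * Vᵀ) - b) = euclNorm (sense A (Ut * Vtilᵀ) - b) → V = Vtil)
    (hVtil_rank : Vtil.rank = k) :
    (∀ V : Matrix (Fin n) (Fin k) ℝ,
        euclNorm (sense A (Uhat * Vᵀ) - b) = euclNorm (sense A (Uhat * Vhatᵀ) - b) → V = Vhat) ∧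
      Vhat.rank = k ∧ colProj Vhat = colProj Vtil ∧
      Vhat = Vtil * ((RU * R)ᵀ)⁻¹ := by
  have hU : Uhat = Ut * (RU * R) := by rw [hR, hQR, Matrix.mul_assoc]
  have hS : IsUnit (RU * R).det := isUnit_det_of_rank_mul_eq (hU ▸ hUhat_rank)
  generalize RU * R = S at hU hS ⊢
  have hSt : IsUnit Sᵀ.det := by rwa [det_transpose]
  have hSi : IsUnit (Sᵀ)⁻¹.det := isUnit_nonsing_inv_det _ hSt
  have hmul : ∀ V : Matrix (Fin n) (Fin k) ℝ, Uhat * Vᵀ = Ut * (V * Sᵀ)ᵀ := fun V => by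
    rw [hU, transpose_mul, transpose_transpose, Matrix.mul_assoc]
  have hVtil_min : euclNorm (sense A (Uhat * Vhatᵀ) - b) = euclNorm (sense A (Ut * Vtilᵀ) - b) := by
    refine le_antisymm ?_ (hmul Vhat ▸ hVtil _)
    have h := hVhat (Vtil * (Sᵀ)⁻¹)
    rwa [hmul (Vtil * (Sᵀ)⁻¹), nonsing_inv_mul_cancel_right _ _ hSt] at h
  have key : ∀ V : Matrix (Fin n) (Fin k) ℝ,
      euclNorm (sense A (Uhat * Vᵀ) - b) = euclNorm (sense A (Uhat * Vhatᵀ) - b) →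
        V = Vtil * (Sᵀ)⁻¹ := fun V hV => by
    rw [← hVtil_unique (V * Sᵀ) (by rw [← hmul, hV, hVtil_min]),
      mul_nonsing_inv_cancel_right _ _ hSt]
  have hVhat_eq := key Vhat rfl
  refine ⟨fun V hV => (key V hV).trans hVhat_eq.symm, ?_, ?_, hVhat_eq⟩
  · rw [hVhat_eq, rank_mul_eq_left_of_isUnit_det _ _ hSi, hVtil_rank]
  · rw [hVhat_eq, colProj_mul_of_isUnit_det _ hSi]

end AltMin
end
end

section
/- In the rank-1 matrix completion setting, let M = σ*u*(v*)ᵀ with μ-incoherent unit vectors u*, v*, let Ω sample entries independently with probability p as in the main completion theorem, and let u^t be a unit vector with incoherence parameter μ₁ = 6(1+δ₂)μ/(1−δ₂) satisfying dist(u^0, u*) ≤ 3/50 for the initial iterate. Then with probability at least 1 − 1/n³, the normalized next iterate v^{t+1} = v̂^{t+1}/‖v̂^{t+1}‖₂ of alternating minimization satisfies ‖v^{t+1}‖∞ ≤ μ₁/√n, i.e., v^{t+1} is also μ₁-incoherent. -/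
open Matrix MeasureTheory Finset

noncomputable section

namespace AltMin

lemma isProbabilityMeasure_bernoulliMeasure {p : ℝ} (hp0 : 0 ≤ p) (hp1 : p ≤ 1) :
    IsProbabilityMeasure (bernoulliMeasure p) := by
  constructor
  simp only [bernoulliMeasure, Measure.add_apply, Measure.smul_apply, measure_univ, smul_eq_mul,
    mul_one]
  rw [← ENNReal.ofReal_add hp0 (by linarith)]
  simp

lemma integral_bernoulliMeasure {p : ℝ} (hp0 : 0 ≤ p) (hp1 : p ≤ 1) (f : Bool → ℝ) :
    ∫ b, f b ∂(bernoulliMeasure p) = p * f true + (1 - p) * f false := by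
  rw [bernoulliMeasure, integral_add_measure, integral_smul_measure, integral_smul_measure,
    integral_dirac, integral_dirac, ENNReal.toReal_ofReal hp0,
    ENNReal.toReal_ofReal (by linarith)]
  · rfl
  · exact (Integrable.of_finite).smul_measure ENNReal.ofReal_ne_top
  · exact (Integrable.of_finite).smul_measure ENNReal.ofReal_ne_top

/-- The indicator of `b = true`, as a real number. -/
def boolInd (b : Bool) : ℝ := if b then 1 else 0

/-- Subgaussian-type bound for the moment generating function of a centred Bernoulli variable. -/
lemma integral_exp_bernoulli_le {p x : ℝ} (hp0 : 0 ≤ p) (hp1 : p ≤ 1) (hx : |x| ≤ 1) :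
    ∫ b, Real.exp (x * (boolInd b - p)) ∂(bernoulliMeasure p) ≤ Real.exp (p * x ^ 2) := by
  rw [integral_bernoulliMeasure hp0 hp1]
  have h1 : Real.exp x - 1 - x ≤ x ^ 2 :=
    (le_abs_self _).trans (Real.abs_exp_sub_one_sub_id_le hx)
  have h2 : p * (Real.exp x - 1) + 1 ≤ Real.exp (p * (Real.exp x - 1)) := Real.add_one_le_exp _
  have h3 : Real.exp (x * (boolInd true - p)) = Real.exp x * Real.exp (-(p * x)) := by
    rw [← Real.exp_add]; simp only [boolInd, if_true]; ring_nf
  have h4 : Real.exp (x * (boolInd false - p)) = Real.exp (-(p * x)) := by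
    simp only [boolInd]; congr 1; simp; ring
  rw [h3, h4]
  calc p * (Real.exp x * Real.exp (-(p * x))) + (1 - p) * Real.exp (-(p * x))
      = (p * (Real.exp x - 1) + 1) * Real.exp (-(p * x)) := by ring
    _ ≤ Real.exp (p * (Real.exp x - 1)) * Real.exp (-(p * x)) := by gcongr
    _ = Real.exp (p * (Real.exp x - 1 - x)) := by rw [← Real.exp_add]; ring_nf
    _ ≤ Real.exp (p * x ^ 2) := by gcongr

/-- One-sided Bernstein-type bound for a weighted sum of independent centred Bernoulli variables. -/
lemma measureReal_pi_bernoulli_ge_le {ι : Type*} [Fintype ι] {p β ε : ℝ} (hp0 : 0 ≤ p)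
    (hp1 : p ≤ 1) (hβ : 0 < β) (hε0 : 0 ≤ ε) (hε1 : ε ≤ 1) (a : ι → ℝ)
    (ha : ∀ i, |a i| ≤ β) (ha2 : ∑ i, a i ^ 2 ≤ β) :
    (Measure.pi fun _ : ι => bernoulliMeasure p).real
      {ω | p * ε ≤ ∑ i, a i * (boolInd (ω i) - p)} ≤ Real.exp (-(p * ε ^ 2 / (4 * β))) := by
  have := isProbabilityMeasure_bernoulliMeasure hp0 hp1
  set s : ℝ := ε / (2 * β) with hs
  have hs0 : 0 ≤ s := by positivity
  refine (ProbabilityTheory.measure_ge_le_exp_mul_mgf (p * ε) hs0 Integrable.of_finite).trans ?_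
  have hmgf : ProbabilityTheory.mgf (fun ω : ι → Bool => ∑ i, a i * (boolInd (ω i) - p))
      (Measure.pi fun _ : ι => bernoulliMeasure p) s ≤ Real.exp (p * s ^ 2 * β) := by
    have h1 : ∀ ω : ι → Bool, Real.exp (s * ∑ i, a i * (boolInd (ω i) - p))
        = ∏ i, Real.exp (s * a i * (boolInd (ω i) - p)) := by
      intro ω
      rw [← Real.exp_sum, Finset.mul_sum]
      simp only [mul_assoc]
    simp only [ProbabilityTheory.mgf, h1]
    rw [integral_fintype_prod_eq_prod (fun i b => Real.exp (s * a i * (boolInd b - p)))]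
    calc ∏ i, ∫ b, Real.exp (s * a i * (boolInd b - p)) ∂(bernoulliMeasure p)
        ≤ ∏ i, Real.exp (p * (s * a i) ^ 2) := by
          refine Finset.prod_le_prod (fun i _ => integral_nonneg fun b => (Real.exp_pos _).le) ?_
          intro i _
          refine integral_exp_bernoulli_le hp0 hp1 ?_
          rw [abs_mul, abs_of_nonneg hs0]
          calc s * |a i| ≤ s * β := by gcongr; exact ha i
            _ = ε / 2 := by rw [hs]; field_simp
            _ ≤ 1 := by linarith
      _ = Real.exp (p * s ^ 2 * ∑ i, a i ^ 2) := by
          rw [← Real.exp_sum, Finset.mul_sum]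
          congr 1
          exact Finset.sum_congr rfl fun i _ => by ring
      _ ≤ Real.exp (p * s ^ 2 * β) := by gcongr
  calc Real.exp (-s * (p * ε)) * ProbabilityTheory.mgf
        (fun ω : ι → Bool => ∑ i, a i * (boolInd (ω i) - p))
        (Measure.pi fun _ : ι => bernoulliMeasure p) s
      ≤ Real.exp (-s * (p * ε)) * Real.exp (p * s ^ 2 * β) := by gcongr
    _ = Real.exp (-(p * ε ^ 2 / (4 * β))) := by
        rw [← Real.exp_add]
        congr 1
        rw [hs]
        field_simp
        ring

/-- Two-sided concentration of the sampled sum of a column of weights. -/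
lemma sampleMeasure_real_column_le {m n : ℕ} {p β ε : ℝ} (hp0 : 0 ≤ p)
    (hp1 : p ≤ 1) (hβ : 0 < β) (hε0 : 0 ≤ ε) (hε1 : ε ≤ 1) (a : Fin m → ℝ)
    (ha : ∀ i, |a i| ≤ β) (ha2 : ∑ i, a i ^ 2 ≤ β) (j : Fin n) :
    (sampleMeasure m n p).real
      {ω | p * ε ≤ |∑ i, boolInd (ω (i, j)) * a i - p * ∑ i, a i|}
      ≤ 2 * Real.exp (-(p * ε ^ 2 / (4 * β))) := by
  have := isProbabilityMeasure_bernoulliMeasure hp0 hp1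
  have key : ∀ b : Fin m → ℝ, (∀ i, |b i| ≤ β) → ∑ i, b i ^ 2 ≤ β →
      (sampleMeasure m n p).real
        {ω | p * ε ≤ ∑ i, boolInd (ω (i, j)) * b i - p * ∑ i, b i}
        ≤ Real.exp (-(p * ε ^ 2 / (4 * β))) := by
    intro b hb hb2
    have h := measureReal_pi_bernoulli_ge_le hp0 hp1 hβ hε0 hε1
      (fun q : Fin m × Fin n => if q.2 = j then b q.1 else 0)
      (fun q => by
        by_cases hq : q.2 = j
        · simpa [hq] using hb q.1
        · simpa [hq] using hβ.le)
      (by simpa [Fintype.sum_prod_type, ite_pow] using hb2)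
    refine le_trans (le_of_eq ?_) h
    rw [sampleMeasure]
    congr 1
    ext ω
    simp only [Set.mem_ofPred_eq, Fintype.sum_prod_type, ite_mul, zero_mul, Finset.sum_ite_eq',
      Finset.mem_univ, if_true]
    rw [Finset.mul_sum, ← Finset.sum_sub_distrib]
    exact Eq.to_iff (congrArg _ (Finset.sum_congr rfl fun i _ => by ring))
  have h1 := key a ha ha2
  have h2 := key (fun i => -a i) (by simpa using ha) (by simpa using ha2)
  have : IsProbabilityMeasure (sampleMeasure m n p) := by
    unfold sampleMeasure; infer_instance
  calc _ ≤ (sampleMeasure m n p).real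
        ({ω | p * ε ≤ ∑ i, boolInd (ω (i, j)) * a i - p * ∑ i, a i} ∪
          {ω | p * ε ≤ ∑ i, boolInd (ω (i, j)) * (-a i) - p * ∑ i, -a i}) := by
        refine measureReal_mono fun ω hω => ?_
        rcases le_abs.1 (Set.mem_ofPred_eq ▸ hω) with h | h
        · exact Or.inl h
        · right
          simp only [Set.mem_ofPred_eq, mul_neg, Finset.sum_neg_distrib]
          linarith
    _ ≤ _ := (measureReal_union_le _ _).trans (by linarith)

/-- Under positive column energies, any minimizer of the rank-one least-squares objective is
given columnwise by the normal equations. -/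
lemma column_normal_equation {m n : ℕ} (ω : Fin m × Fin n → Bool) (σs : ℝ)
    (ustar ut : Fin m → ℝ) (vstar vhat : Fin n → ℝ)
    (hB : ∀ j, 0 < ∑ i, boolInd (ω (i, j)) * ut i ^ 2)
    (hmin : ∀ v : Fin n → ℝ,
      (∑ i, ∑ j, if ω (i, j) then (σs * ustar i * vstar j - ut i * vhat j) ^ 2 else 0) ≤
        ∑ i, ∑ j, if ω (i, j) then (σs * ustar i * vstar j - ut i * v j) ^ 2 else 0)
    (j : Fin n) :
    (∑ i, boolInd (ω (i, j)) * ut i ^ 2) * vhat j =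
      σs * vstar j * ∑ i, boolInd (ω (i, j)) * (ut i * ustar i) := by
  set B : Fin n → ℝ := fun j => ∑ i, boolInd (ω (i, j)) * ut i ^ 2 with hBdef
  set C : Fin n → ℝ := fun j => ∑ i, boolInd (ω (i, j)) * (ut i * ustar i) with hCdef
  set D : Fin n → ℝ := fun j => ∑ i, boolInd (ω (i, j)) * ustar i ^ 2 with hDdef
  have hobj : ∀ v : Fin n → ℝ,
      (∑ i, ∑ j, if ω (i, j) then (σs * ustar i * vstar j - ut i * v j) ^ 2 else 0) =
        ∑ j, (B j * v j ^ 2 - 2 * σs * vstar j * v j * C j + σs ^ 2 * vstar j ^ 2 * D j) := by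
    intro v
    rw [Finset.sum_comm]
    refine Finset.sum_congr rfl fun j _ => ?_
    simp only [hBdef, hCdef, hDdef, Finset.sum_mul, Finset.mul_sum]
    rw [← Finset.sum_sub_distrib, ← Finset.sum_add_distrib]
    refine Finset.sum_congr rfl fun i _ => ?_
    unfold boolInd
    split_ifs <;> ring
  have h := hmin fun j => σs * vstar j * C j / B j
  rw [hobj, hobj, ← sub_nonpos, ← Finset.sum_sub_distrib] at h
  have hsq : ∀ j, (B j * vhat j ^ 2 - 2 * σs * vstar j * vhat j * C j
        + σs ^ 2 * vstar j ^ 2 * D j)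
      - (B j * (σs * vstar j * C j / B j) ^ 2
        - 2 * σs * vstar j * (σs * vstar j * C j / B j) * C j + σs ^ 2 * vstar j ^ 2 * D j)
      = (B j * vhat j - σs * vstar j * C j) ^ 2 / B j := by
    intro j
    have := (hB j).ne'
    change B j ≠ 0 at this
    field_simp
    ring
  simp only [hsq] at h
  have hnn : ∀ j ∈ Finset.univ, 0 ≤ (B j * vhat j - σs * vstar j * C j) ^ 2 / B j :=
    fun j _ => div_nonneg (sq_nonneg _) (hB j).le
  have h0 := (Finset.sum_eq_zero_iff_of_nonneg hnn).1 (le_antisymm h (Finset.sum_nonneg hnn)) j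
    (Finset.mem_univ j)
  rcases div_eq_zero_iff.1 h0 with h0 | h0
  · linarith [pow_eq_zero_iff (two_ne_zero) |>.1 h0]
  · exact absurd h0 (hB j).ne'

lemma sum_sq_eq_one_of_euclNorm_eq_one {ι : Type*} [Fintype ι] {v : ι → ℝ}
    (h : euclNorm v = 1) : ∑ i, v i ^ 2 = 1 := by
  rwa [euclNorm, Real.sqrt_eq_one] at h

/-- A vector whose coordinates are comparable to those of a unit vector `w`, up to the factors
`lo` and `hi`, has normalized coordinates at most `hi / lo` times those of `w`. -/
lemma abs_div_euclNorm_le {ι : Type*} [Fintype ι] {v w : ι → ℝ} {lo hi : ℝ} (hlo : 0 < lo)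
    (hw : euclNorm w = 1) (hl : ∀ j, lo * |w j| ≤ |v j|) (hu : ∀ j, |v j| ≤ hi * |w j|) (j : ι) :
    |v j / euclNorm v| ≤ hi / lo * |w j| := by
  have hnorm : lo ≤ euclNorm v := by
    refine Real.le_sqrt_of_sq_le ?_
    calc lo ^ 2 = ∑ i, lo ^ 2 * w i ^ 2 := by
          rw [← Finset.mul_sum, sum_sq_eq_one_of_euclNorm_eq_one hw, mul_one]
      _ ≤ ∑ i, v i ^ 2 := by
          refine Finset.sum_le_sum fun i _ => ?_
          have := pow_le_pow_left₀ (by positivity) (hl i) 2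
          rwa [mul_pow, sq_abs, sq_abs] at this
  rw [abs_div, abs_of_pos (hlo.trans_le hnorm), div_mul_eq_mul_div]
  exact div_le_div₀ ((abs_nonneg _).trans (hu j)) (hu j) hlo hnorm

/-- If the sampled column energies and correlations are within `p / 10` of their means, then the
normalized minimizer is entrywise at most six times as large as `vstar`. -/
lemma abs_minimizer_div_euclNorm_le {m n : ℕ} (ω : Fin m × Fin n → Bool) {σs p : ℝ}
    (hσ : 0 < σs) (hp : 0 < p) {ustar ut : Fin m → ℝ} {vstar vhat : Fin n → ℝ}
    (hvs : euclNorm vstar = 1)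
    (hα0 : 9 / 10 ≤ |∑ i, ut i * ustar i|) (hα1 : |∑ i, ut i * ustar i| ≤ 1)
    (hB : ∀ j, |∑ i, boolInd (ω (i, j)) * ut i ^ 2 - p| < p * (1 / 10))
    (hC : ∀ j, |∑ i, boolInd (ω (i, j)) * (ut i * ustar i) - p * ∑ i, ut i * ustar i|
      < p * (1 / 10))
    (hmin : ∀ v : Fin n → ℝ,
      (∑ i, ∑ j, if ω (i, j) then (σs * ustar i * vstar j - ut i * vhat j) ^ 2 else 0) ≤
        ∑ i, ∑ j, if ω (i, j) then (σs * ustar i * vstar j - ut i * v j) ^ 2 else 0)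
    (j : Fin n) :
    |vhat j / euclNorm vhat| ≤ 6 * |vstar j| := by
  have hBpos : ∀ j, 0 < ∑ i, boolInd (ω (i, j)) * ut i ^ 2 := fun j => by
    linarith [(abs_lt.1 (hB j)).1]
  have heq := column_normal_equation ω σs ustar ut vstar vhat hBpos hmin
  have habs : ∀ j, (∑ i, boolInd (ω (i, j)) * ut i ^ 2) * |vhat j| =
      σs * |vstar j| * |∑ i, boolInd (ω (i, j)) * (ut i * ustar i)| := fun j => by
    have := congrArg abs (heq j)
    rwa [abs_mul, abs_mul, abs_mul, abs_of_pos hσ, abs_of_pos (hBpos j)] at this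
  have hCabs : ∀ j, p * (8 / 10) ≤ |∑ i, boolInd (ω (i, j)) * (ut i * ustar i)| ∧
      |∑ i, boolInd (ω (i, j)) * (ut i * ustar i)| ≤ p * (11 / 10) := fun j => by
    have h := (abs_abs_sub_abs_le _ _).trans_lt (hC j)
    rw [abs_mul, abs_of_pos hp, abs_lt] at h
    constructor <;> nlinarith
  have hlo : ∀ j, σs * (8 / 11) * |vstar j| ≤ |vhat j| := fun j => by
    have h1 := (abs_lt.1 (hB j)).2
    have h2 : σs * |vstar j| * (p * (8 / 10)) ≤ p * (11 / 10) * |vhat j| := by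
      calc _ ≤ σs * |vstar j| * |∑ i, boolInd (ω (i, j)) * (ut i * ustar i)| := by
            gcongr; exact (hCabs j).1
        _ = _ := (habs j).symm
        _ ≤ _ := by gcongr; linarith
    refine le_of_mul_le_mul_left ?_ (show 0 < p * (11 / 10) by positivity)
    linarith
  have hhi : ∀ j, |vhat j| ≤ σs * (11 / 9) * |vstar j| := fun j => by
    have h1 := (abs_lt.1 (hB j)).1
    have h2 : p * (9 / 10) * |vhat j| ≤ σs * |vstar j| * (p * (11 / 10)) := by
      calc _ ≤ (∑ i, boolInd (ω (i, j)) * ut i ^ 2) * |vhat j| := by gcongr; linarith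
        _ = _ := habs j
        _ ≤ _ := by gcongr; exact (hCabs j).2
    refine le_of_mul_le_mul_left ?_ (show 0 < p * (9 / 10) by positivity)
    linarith
  refine (abs_div_euclNorm_le (by positivity) hvs hlo hhi j).trans ?_
  gcongr
  rw [div_le_iff₀ (by positivity)]
  linarith

/-- Lemma: the normalized rank-1 completion iterate stays incoherent:
with probability at least `1 − 1/n³`, every minimizer `v̂^{t+1}` of
`∑_{(i,j)∈Ω}(M_{ij} − u^t_i v_j)²` has `μ₁`-incoherent normalization:
`‖v̂^{t+1}/‖v̂^{t+1}‖₂‖_∞ ≤ μ₁/√n`.  (The hypothesis `dist(u⁰,u*) ≤ 3/50` on the initial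
iterate is reflected by the distance bound on the current iterate `u^t`, which alternating
minimization only decreases.) -/
theorem rank1_incoherence_next_iterate :
    ∃ C₀ : ℝ, 0 < C₀ ∧
      ∀ (m n : ℕ) (p δ μ μ₁ σs : ℝ)
        (M : Matrix (Fin m) (Fin n) ℝ)
        (ustar : Fin m → ℝ) (vstar : Fin n → ℝ) (ut : Fin m → ℝ),
        0 < σs →
        M = (fun i j => σs * ustar i * vstar j) →
        euclNorm ustar = 1 → euclNorm vstar = 1 → euclNorm ut = 1 →
        -- `μ`-incoherence of `u*` and `v*`, `μ₁`-incoherence of `u^t`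
        (∀ i, |ustar i| ≤ μ / Real.sqrt m) →
        (∀ j, |vstar j| ≤ μ / Real.sqrt n) →
        (∀ i, |ut i| ≤ μ₁ / Real.sqrt m) →
        μ₁ = 6 * (1 + δ) * μ / (1 - δ) →
        -- `dist(u^t, u*) ≤ dist(u⁰, u*) ≤ 3/50`
        Real.sqrt (1 - (ut ⬝ᵥ ustar) ^ 2) ≤ 3 / 50 →
        0 < δ → 0 < p → p ≤ 1 →
        C₀ * μ₁ ^ 2 * Real.log n / (m * δ ^ 2) ≤ p →
        ENNReal.ofReal (1 - 1 / (n : ℝ) ^ 3) ≤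
          sampleMeasure m n p
            {ω : (Fin m × Fin n) → Bool |
              ∀ vhat : Fin n → ℝ,
                (∀ v : Fin n → ℝ,
                  (∑ i, ∑ j, if ω (i, j) then (M i j - ut i * vhat j) ^ 2 else 0) ≤
                    ∑ i, ∑ j, if ω (i, j) then (M i j - ut i * v j) ^ 2 else 0) →
                ∀ j, |vhat j / euclNorm vhat| ≤ μ₁ / Real.sqrt n} := by
  refine ⟨2400, by norm_num, ?_⟩
  intro m n p δ μ μ₁ σs M ustar vstar ut hσ hM hus hvs hut hus_inc hvs_inc hut_inc hμ₁ hdist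
    hδ hp hp1 hsample
  have hus2 := sum_sq_eq_one_of_euclNorm_eq_one hus
  have hvs2 := sum_sq_eq_one_of_euclNorm_eq_one hvs
  have hut2 := sum_sq_eq_one_of_euclNorm_eq_one hut
  have hm : 0 < m := by
    rcases Nat.eq_zero_or_pos m with rfl | h
    · simp at hus2
    · exact h
  have hn : 0 < n := by
    rcases Nat.eq_zero_or_pos n with rfl | h
    · simp at hvs2
    · exact h
  have hm' : (0 : ℝ) < m := by exact_mod_cast hm
  have hn' : (0 : ℝ) < n := by exact_mod_cast hn
  have pos_of_inc : ∀ (k : ℕ) (w : Fin k → ℝ) (ν : ℝ), ∑ i, w i ^ 2 = 1 →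
      (∀ i, |w i| ≤ ν / Real.sqrt k) → 0 < ν := by
    intro k w ν hw h
    by_contra! hν
    have h0 : ∀ i, w i = 0 := fun i => abs_nonpos_iff.1
      ((h i).trans (div_nonpos_of_nonpos_of_nonneg hν (Real.sqrt_nonneg _)))
    simp [h0] at hw
  have hμ : 0 < μ := pos_of_inc n vstar μ hvs2 hvs_inc
  have hμ₁pos : 0 < μ₁ := pos_of_inc m ut μ₁ hut2 hut_inc
  have hδ1 : δ < 1 := by
    by_contra! h
    have : μ₁ ≤ 0 := by
      rw [hμ₁]
      exact div_nonpos_of_nonneg_of_nonpos (by positivity) (by linarith)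
    linarith
  have hμμ₁ : 6 * μ ≤ μ₁ := by
    rw [hμ₁, le_div_iff₀ (by linarith)]
    nlinarith [mul_pos hδ hμ]
  have hα1 : |∑ i, ut i * ustar i| ≤ 1 := by
    have := Finset.sum_mul_sq_le_sq_mul_sq Finset.univ ut ustar
    rw [hut2, hus2, one_mul] at this
    exact (sq_le_one_iff_abs_le_one _).1 this
  have hα0 : 9 / 10 ≤ |∑ i, ut i * ustar i| := by
    rw [Real.sqrt_le_left (by norm_num)] at hdist
    refine le_of_sq_le_sq ?_ (abs_nonneg _)
    rw [sq_abs]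
    change 1 - (∑ i, ut i * ustar i) ^ 2 ≤ _ at hdist
    linarith
  set β : ℝ := μ₁ ^ 2 / m with hβdef
  have hβ : 0 < β := by positivity
  have hut_sq : ∀ i, ut i ^ 2 ≤ β := fun i => by
    have := pow_le_pow_left₀ (abs_nonneg _) (hut_inc i) 2
    rwa [sq_abs, div_pow, Real.sq_sqrt hm'.le] at this
  have hus_abs : ∀ i, |ustar i| ≤ μ₁ / Real.sqrt m := fun i =>
    (hus_inc i).trans (by gcongr; linarith)
  have hβ_sqrt : β = μ₁ / Real.sqrt m * (μ₁ / Real.sqrt m) := by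
    rw [div_mul_div_comm, Real.mul_self_sqrt hm'.le, hβdef, sq]
  have := isProbabilityMeasure_bernoulliMeasure hp.le hp1
  have : IsProbabilityMeasure (sampleMeasure m n p) := by
    unfold sampleMeasure; infer_instance
  have htailB := fun j : Fin n => sampleMeasure_real_column_le (ε := 1 / 10) hp.le hp1 hβ
    (by norm_num) (by norm_num) (fun i => ut i ^ 2)
    (fun i => by rw [abs_of_nonneg (sq_nonneg _)]; exact hut_sq i)
    (by
      calc ∑ i, (ut i ^ 2) ^ 2 ≤ ∑ i, β * ut i ^ 2 := by
            refine Finset.sum_le_sum fun i _ => ?_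
            rw [sq (ut i ^ 2)]
            gcongr
            exact hut_sq i
        _ = β := by rw [← Finset.mul_sum, hut2, mul_one]) j
  have htailC := fun j : Fin n => sampleMeasure_real_column_le (ε := 1 / 10) hp.le hp1 hβ
    (by norm_num) (by norm_num) (fun i => ut i * ustar i)
    (fun i => by
      rw [abs_mul, hβ_sqrt]
      gcongr
      · exact hut_inc i
      · exact hus_abs i)
    (by
      calc ∑ i, (ut i * ustar i) ^ 2 ≤ ∑ i, β * ustar i ^ 2 := by
            refine Finset.sum_le_sum fun i _ => ?_
            rw [mul_pow]
            gcongr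
            exact hut_sq i
        _ = β := by rw [← Finset.mul_sum, hus2, mul_one]) j
  rw [hut2, mul_one] at htailB
  rcases Nat.lt_or_ge n 2 with hn2 | hn2
  · have : n = 1 := by omega
    subst this
    simp
  have hn2' : (2 : ℝ) ≤ n := by exact_mod_cast hn2
  have hlog : 0 ≤ Real.log n := Real.log_natCast_nonneg n
  have hp_lower : 2400 * β * Real.log n ≤ p := by
    refine le_trans ?_ hsample
    rw [hβdef, le_div_iff₀ (by positivity)]
    calc 2400 * (μ₁ ^ 2 / m) * Real.log n * (m * δ ^ 2)
        = 2400 * μ₁ ^ 2 * Real.log n * δ ^ 2 := by field_simp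
      _ ≤ 2400 * μ₁ ^ 2 * Real.log n :=
          mul_le_of_le_one_right (by positivity) (pow_le_one₀ hδ.le hδ1.le)
  have htail : Real.exp (-(p * (1 / 10) ^ 2 / (4 * β))) ≤ ((n : ℝ) ^ 6)⁻¹ := by
    rw [Real.exp_neg]
    refine inv_anti₀ (by positivity) ?_
    rw [← Real.exp_log (show (0 : ℝ) < (n : ℝ) ^ 6 by positivity), Real.log_pow]
    refine Real.exp_le_exp.2 ?_
    rw [le_div_iff₀ (by positivity)]
    push_cast
    linarith
  set bad : Set (Fin m × Fin n → Bool) := ⋃ j,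
    ({ω | p * (1 / 10) ≤ |∑ i, boolInd (ω (i, j)) * ut i ^ 2 - p|} ∪
      {ω | p * (1 / 10) ≤ |∑ i, boolInd (ω (i, j)) * (ut i * ustar i)
        - p * ∑ i, ut i * ustar i|}) with hbad
  have hbad_le : (sampleMeasure m n p).real bad ≤ 1 / (n : ℝ) ^ 3 := by
    calc (sampleMeasure m n p).real bad ≤ ∑ _j : Fin n, 4 * ((n : ℝ) ^ 6)⁻¹ := by
          refine (measureReal_iUnion_fintype_le _).trans (Finset.sum_le_sum fun j _ => ?_)
          refine (measureReal_union_le _ _).trans ?_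
          linarith [htailB j, htailC j]
      _ = 4 / (n : ℝ) ^ 5 := by
          rw [Finset.sum_const, Finset.card_univ, Fintype.card_fin, nsmul_eq_mul]
          field_simp
      _ ≤ 1 / (n : ℝ) ^ 3 := by
          rw [div_le_div_iff₀ (by positivity) (by positivity)]
          have : (4 : ℝ) ≤ (n : ℝ) ^ 2 := by nlinarith
          calc 4 * (n : ℝ) ^ 3 ≤ (n : ℝ) ^ 2 * (n : ℝ) ^ 3 := by gcongr
            _ = 1 * (n : ℝ) ^ 5 := by ring
  have hgood : ENNReal.ofReal (1 - 1 / (n : ℝ) ^ 3) ≤ sampleMeasure m n p badᶜ := by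
    rw [← ofReal_measureReal, probReal_compl_eq_one_sub (Set.toFinite bad).measurableSet]
    exact ENNReal.ofReal_le_ofReal (by linarith)
  refine hgood.trans (measure_mono fun ω hω => ?_)
  simp only [hbad, Set.mem_compl_iff, Set.mem_iUnion, Set.mem_union, Set.mem_ofPred_eq,
    not_exists, not_or, not_le] at hω
  intro vhat hmin j
  subst hM
  calc |vhat j / euclNorm vhat| ≤ 6 * |vstar j| :=
        abs_minimizer_div_euclNorm_le ω hσ hp hvs hα0 hα1 (fun j => (hω j).1)
          (fun j => (hω j).2) hmin j
    _ ≤ 6 * (μ / Real.sqrt n) := by gcongr; exact hvs_inc j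
    _ = 6 * μ / Real.sqrt n := by ring
    _ ≤ μ₁ / Real.sqrt n := by gcongr

end AltMin
end
end
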